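/- arXiv:math/0202108 — 8 statements merged into one kernel-verified Lean document; each statement's English description precedes it below -/
import Mathlib

section
/- Let f : ℝ → ℝ be non-decreasing, right-continuous, bounded from below and unbounded from above. Then the limits lim_{h→∞} limsup_{t→∞} (f(t+h)−f(t))/h and lim_{h→∞} liminf_{t→∞} (f(t+h)−f(t))/h exist in [0,+∞], and moreover lim_{h→∞} limsup_{t→∞} (f(t+h)−f(t))/h = inf_{h>0} limsup_{t→∞} (f(t+h)−f(t))/h ≥ limsup_{t→∞} f(t)/t ≥ liminf_{t→∞} f(t)/t ≥ sup_{h>0} liminf_{t→∞} (f(t+h)−f(t))/h = lim_{h→∞} liminf_{t→∞} (f(t+h)−f(t))/h. -/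
open Filter

/-- The linear function `c x + d` is eventually below a linear function of larger slope. -/
theorem eventually_linear_le {c c' : ℝ} (hc : c < c') (d : ℝ) :
    ∀ᶠ x : ℝ in atTop, c * x + d ≤ c' * x := by
  filter_upwards [eventually_ge_atTop (d / (c' - c))] with x hx
  rw [div_le_iff₀ (sub_pos.2 hc)] at hx
  linarith

/-- An upper bound on increments of step `h` propagates to increments of step `n * h`. -/
theorem increment_nat_mul_le {f : ℝ → ℝ} {h c T : ℝ} (hh : 0 ≤ h)
    (hf : ∀ t ≥ T, f (t + h) - f t ≤ c * h) (n : ℕ) :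
    ∀ t ≥ T, f (t + n * h) - f t ≤ c * (n * h) := by
  intro t ht
  induction n with
  | zero => simp
  | succ n ih =>
    have key := hf (t + n * h) (by nlinarith [mul_nonneg n.cast_nonneg hh])
    rw [show t + n * h + h = t + ((n + 1 : ℕ) : ℝ) * h by push_cast; ring] at key
    push_cast at key ⊢
    linarith

/-- A lower bound on increments of step `h` propagates to increments of step `n * h`. -/
theorem le_increment_nat_mul {f : ℝ → ℝ} {h c T : ℝ} (hh : 0 ≤ h)
    (hf : ∀ t ≥ T, c * h ≤ f (t + h) - f t) (n : ℕ) :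
    ∀ t ≥ T, c * (n * h) ≤ f (t + n * h) - f t := by
  intro t ht
  have := increment_nat_mul_le (f := fun x => -f x) (c := -c) hh
    (fun t ht => by linarith [hf t ht]) n t ht
  linarith

theorem Monotone.increment_le {f : ℝ → ℝ} (hmono : Monotone f) {h c T : ℝ} (hh : 0 < h)
    (hc : 0 ≤ c) (hf : ∀ t ≥ T, f (t + h) - f t ≤ c * h) {t H : ℝ} (ht : T ≤ t) (hH : 0 ≤ H) :
    f (t + H) - f t ≤ c * (H + h) := by
  have h1 : H ≤ ⌈H / h⌉₊ * h := (div_le_iff₀ hh).1 (Nat.le_ceil _)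
  have h2 : (⌈H / h⌉₊ : ℝ) * h ≤ H + h := by
    have := mul_le_mul_of_nonneg_right (Nat.ceil_lt_add_one (div_nonneg hH hh.le)).le hh.le
    rwa [add_mul, div_mul_cancel₀ _ hh.ne', one_mul] at this
  have h3 := increment_nat_mul_le hh.le hf ⌈H / h⌉₊ t ht
  have h4 := hmono (add_le_add_right h1 t)
  have h5 := mul_le_mul_of_nonneg_left h2 hc
  linarith

theorem Monotone.le_increment {f : ℝ → ℝ} (hmono : Monotone f) {h c T : ℝ} (hh : 0 < h)
    (hc : 0 ≤ c) (hf : ∀ t ≥ T, c * h ≤ f (t + h) - f t) {t H : ℝ} (ht : T ≤ t) (hH : 0 ≤ H) :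
    c * (H - h) ≤ f (t + H) - f t := by
  have h1 : ⌊H / h⌋₊ * h ≤ H := (le_div_iff₀ hh).1 (Nat.floor_le (div_nonneg hH hh.le))
  have h2 : H - h ≤ (⌊H / h⌋₊ : ℝ) * h := by
    have := mul_le_mul_of_nonneg_right (Nat.lt_floor_add_one (H / h)).le hh.le
    rw [add_mul, div_mul_cancel₀ _ hh.ne', one_mul] at this
    linarith
  have h3 := le_increment_nat_mul hh.le hf ⌊H / h⌋₊ t ht
  have h4 := hmono (add_le_add_right h1 t)
  have h5 := mul_le_mul_of_nonneg_left h2 hc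
  linarith

/-- If the upper growth rate at some step `h` is below `b`, then so are the upper growth rates at
all large steps, and the upper growth rate of `f t / t` is at most `b`. -/
theorem Monotone.limsup_rate_lt {f : ℝ → ℝ} (hmono : Monotone f) {h : ℝ} (hh : 0 < h) {b : EReal}
    (hb : limsup (fun t : ℝ => (((f (t + h) - f t) / h : ℝ) : EReal)) atTop < b) :
    (∀ᶠ H : ℝ in atTop, limsup (fun t : ℝ => (((f (t + H) - f t) / H : ℝ) : EReal)) atTop < b) ∧
      limsup (fun t : ℝ => ((f t / t : ℝ) : EReal)) atTop ≤ b := by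
  obtain ⟨c, hgc, hcb⟩ := EReal.lt_iff_exists_real_btwn.1 hb
  obtain ⟨c', hcc', hc'b⟩ := EReal.lt_iff_exists_real_btwn.1 hcb
  rw [EReal.coe_lt_coe_iff] at hcc'
  obtain ⟨T, hT⟩ := eventually_atTop.1 (eventually_lt_of_limsup_lt hgc)
  have hf : ∀ t ≥ T, f (t + h) - f t ≤ c * h := fun t ht =>
    (div_le_iff₀ hh).1 (EReal.coe_lt_coe_iff.1 (hT t ht)).le
  have hc : 0 ≤ c := by
    have h1 := hf T le_rfl
    have h2 : f T ≤ f (T + h) := hmono (by linarith)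
    by_contra! h3
    nlinarith
  constructor
  · filter_upwards [eventually_gt_atTop 0, eventually_linear_le hcc' (c * h)] with H hH hlin
    refine lt_of_le_of_lt (limsup_le_of_le (by isBoundedDefault) ?_) hc'b
    filter_upwards [eventually_ge_atTop T] with t ht
    rw [EReal.coe_le_coe_iff, div_le_iff₀ hH]
    linarith [hmono.increment_le hh hc hf ht hH.le]
  · refine le_trans (limsup_le_of_le (by isBoundedDefault) ?_) hc'b.le
    filter_upwards [eventually_gt_atTop 0, eventually_ge_atTop T,
      eventually_linear_le hcc' (f T - c * T + c * h)] with t ht0 ht hlin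
    rw [EReal.coe_le_coe_iff, div_le_iff₀ ht0]
    have := hmono.increment_le hh hc hf le_rfl (sub_nonneg.2 ht)
    rw [add_sub_cancel] at this
    linarith

/-- If the lower growth rate at some step `h` is above `b`, then so are the lower growth rates at
all large steps, and the lower growth rate of `f t / t` is at least `b`. -/
theorem Monotone.lt_liminf_rate {f : ℝ → ℝ} (hmono : Monotone f) {h : ℝ} (hh : 0 < h) {b : EReal}
    (hb : b < liminf (fun t : ℝ => (((f (t + h) - f t) / h : ℝ) : EReal)) atTop) :
    (∀ᶠ H : ℝ in atTop, b < liminf (fun t : ℝ => (((f (t + H) - f t) / H : ℝ) : EReal)) atTop) ∧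
      b ≤ liminf (fun t : ℝ => ((f t / t : ℝ) : EReal)) atTop := by
  obtain ⟨c', hbc', hc'g⟩ := EReal.lt_iff_exists_real_btwn.1 hb
  obtain ⟨a, hc'a, hag⟩ := EReal.lt_iff_exists_real_btwn.1 hc'g
  rw [EReal.coe_lt_coe_iff] at hc'a
  obtain ⟨T, hT⟩ := eventually_atTop.1 (eventually_lt_of_lt_liminf hag)
  obtain ⟨c, hc, hc'c, hf⟩ : ∃ c : ℝ, 0 ≤ c ∧ c' < c ∧ ∀ t ≥ T, c * h ≤ f (t + h) - f t := by
    refine ⟨max a 0, le_max_right _ _, lt_max_of_lt_left hc'a, fun t ht => ?_⟩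
    rw [← le_div_iff₀ hh]
    exact max_le (EReal.coe_lt_coe_iff.1 (hT t ht)).le
      (div_nonneg (sub_nonneg.2 (hmono (by linarith))) hh.le)
  constructor
  · filter_upwards [eventually_gt_atTop 0, eventually_linear_le hc'c (c * h)] with H hH hlin
    refine lt_of_lt_of_le hbc' (le_liminf_of_le (by isBoundedDefault) ?_)
    filter_upwards [eventually_ge_atTop T] with t ht
    rw [EReal.coe_le_coe_iff, le_div_iff₀ hH]
    linarith [hmono.le_increment hh hc hf ht hH.le]
  · refine le_trans hbc'.le (le_liminf_of_le (by isBoundedDefault) ?_)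
    filter_upwards [eventually_gt_atTop 0, eventually_ge_atTop T,
      eventually_linear_le hc'c (c * T + c * h - f T)] with t ht0 ht hlin
    rw [EReal.coe_le_coe_iff, le_div_iff₀ ht0]
    have := hmono.le_increment hh hc hf le_rfl (sub_nonneg.2 ht)
    rw [add_sub_cancel] at this
    linarith

/-- Proposition 1.1 (`constants`): for `f` non-decreasing, right-continuous, bounded below
and unbounded above, the limits `lim_{h→∞} limsup_{t→∞} (f(t+h)-f(t))/h` and
`lim_{h→∞} liminf_{t→∞} (f(t+h)-f(t))/h` exist in `[0,+∞]`, the first equals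
`inf_{h>0} limsup_{t→∞} (f(t+h)-f(t))/h`, the last equals
`sup_{h>0} liminf_{t→∞} (f(t+h)-f(t))/h`, and the chain of inequalities through
`limsup_{t→∞} f(t)/t` and `liminf_{t→∞} f(t)/t` holds. -/
theorem stmt0 (f : ℝ → ℝ) (hmono : Monotone f)
    (hrc : ∀ x : ℝ, ContinuousWithinAt f (Set.Ici x) x)
    (hbdd : BddBelow (Set.range f)) (hunbdd : ¬ BddAbove (Set.range f)) :
    ∃ Lsup Linf : EReal,
      (Tendsto (fun h : ℝ =>
          limsup (fun t : ℝ => (((f (t + h) - f t) / h : ℝ) : EReal)) atTop)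
        atTop (nhds Lsup)) ∧
      (Tendsto (fun h : ℝ =>
          liminf (fun t : ℝ => (((f (t + h) - f t) / h : ℝ) : EReal)) atTop)
        atTop (nhds Linf)) ∧
      (0 ≤ Linf) ∧
      (Lsup = ⨅ h : {h : ℝ // 0 < h},
          limsup (fun t : ℝ => (((f (t + (h : ℝ)) - f t) / (h : ℝ) : ℝ) : EReal)) atTop) ∧
      (Linf = ⨆ h : {h : ℝ // 0 < h},
          liminf (fun t : ℝ => (((f (t + (h : ℝ)) - f t) / (h : ℝ) : ℝ) : EReal)) atTop) ∧
      (limsup (fun t : ℝ => ((f t / t : ℝ) : EReal)) atTop ≤ Lsup) ∧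
      (liminf (fun t : ℝ => ((f t / t : ℝ) : EReal)) atTop ≤
        limsup (fun t : ℝ => ((f t / t : ℝ) : EReal)) atTop) ∧
      (Linf ≤ liminf (fun t : ℝ => ((f t / t : ℝ) : EReal)) atTop) := by
  have hsup (H : ℝ) (hH : 0 < H) := le_iSup (fun h : {h : ℝ // 0 < h} =>
    liminf (fun t : ℝ => (((f (t + (h : ℝ)) - f t) / (h : ℝ) : ℝ) : EReal)) atTop) ⟨H, hH⟩
  have hinf (H : ℝ) (hH : 0 < H) := iInf_le (fun h : {h : ℝ // 0 < h} =>
    limsup (fun t : ℝ => (((f (t + (h : ℝ)) - f t) / (h : ℝ) : ℝ) : EReal)) atTop) ⟨H, hH⟩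
  refine ⟨_, _, ?_, ?_, ?_, rfl, rfl, ?_, liminf_le_limsup, ?_⟩
  · refine tendsto_order.2 ⟨fun a ha => ?_, fun b hb => ?_⟩
    · filter_upwards [eventually_gt_atTop 0] with H hH
      exact ha.trans_le (hinf H hH)
    · obtain ⟨⟨h, hh⟩, hlt⟩ := iInf_lt_iff.1 hb
      exact (hmono.limsup_rate_lt hh hlt).1
  · refine tendsto_order.2 ⟨fun b hb => ?_, fun a ha => ?_⟩
    · obtain ⟨⟨h, hh⟩, hlt⟩ := lt_iSup_iff.1 hb
      exact (hmono.lt_liminf_rate hh hlt).1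
    · filter_upwards [eventually_gt_atTop 0] with H hH
      exact (hsup H hH).trans_lt ha
  · have h0 : (0 : EReal) ≤
        liminf (fun t : ℝ => (((f (t + 1) - f t) / 1 : ℝ) : EReal)) atTop := by
      refine le_liminf_of_le (by isBoundedDefault) (Eventually.of_forall fun t => ?_)
      exact EReal.coe_nonneg.2 (div_nonneg (sub_nonneg.2 (hmono (by simp))) zero_le_one)
    exact h0.trans (hsup 1 one_pos)
  · refine le_of_forall_gt_imp_ge_of_dense fun b hb => ?_
    obtain ⟨⟨h, hh⟩, hlt⟩ := iInf_lt_iff.1 hb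
    exact (hmono.limsup_rate_lt hh hlt).2
  · refine le_of_forall_lt_imp_le_of_dense fun b hb => ?_
    obtain ⟨⟨h, hh⟩, hlt⟩ := lt_iSup_iff.1 hb
    exact (hmono.lt_liminf_rate hh hlt).2
end

section
/- Let f : ℝ → ℝ be non-decreasing, right-continuous, bounded from below and unbounded from above. Then the limit superior of (f(t+h)−f(t))/h along the product filter where both t → ∞ and h → ∞ equals lim_{h→∞} limsup_{t→∞} (f(t+h)−f(t))/h, and the limit inferior of (f(t+h)−f(t))/h along the product filter where both t → ∞ and h → ∞ equals lim_{h→∞} liminf_{t→∞} (f(t+h)−f(t))/h. -/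
open Filter

theorem le_add_nat_mul_of_forall_ge {f : ℝ → ℝ} {T a b : ℝ} (ha : 0 ≤ a)
    (hf : ∀ t, T ≤ t → f (t + a) ≤ f t + b) (n : ℕ) {t : ℝ} (ht : T ≤ t) :
    f (t + n * a) ≤ f t + n * b := by
  induction n with
  | zero => simp
  | succ n ih =>
    have h := hf (t + n * a) (by nlinarith [mul_nonneg (Nat.cast_nonneg (α := ℝ) n) ha])
    push_cast
    rw [show t + ((n : ℝ) + 1) * a = t + n * a + a by ring]
    linarith

theorem eventually_div_le_of_eventually_div_lt {f : ℝ → ℝ} (hf : Monotone f) {a c d : ℝ}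
    (ha : 0 < a) (hdc : d < c) (hd : ∀ᶠ t in atTop, (f (t + a) - f t) / a < d) :
    ∀ᶠ p : ℝ × ℝ in atTop ×ˢ atTop, (f (p.1 + p.2) - f p.1) / p.2 ≤ c := by
  obtain ⟨T, hT⟩ := eventually_atTop.1 hd
  have hd0 : 0 < d :=
    (div_nonneg (sub_nonneg.2 (hf (by linarith))) ha.le).trans_lt (hT T le_rfl)
  filter_upwards [(eventually_ge_atTop T).prod_mk
    ((eventually_gt_atTop 0).and (eventually_ge_atTop (d * a / (c - d))))]
  rintro ⟨t, h⟩ ⟨ht, hh, hh'⟩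
  dsimp only at ht hh hh' ⊢
  rw [div_le_iff₀ (by linarith)] at hh'
  rw [div_le_iff₀ hh]
  have hstep : ∀ t, T ≤ t → f (t + a) ≤ f t + d * a := fun t ht => by
    have := (div_lt_iff₀ ha).1 (hT t ht)
    linarith
  have hle := le_add_nat_mul_of_forall_ge ha.le hstep ⌈h / a⌉₊ ht
  have hceil : h ≤ ⌈h / a⌉₊ * a := (div_le_iff₀ ha).1 (Nat.le_ceil _)
  have hceil' : (⌈h / a⌉₊ : ℝ) * a < h + a := by
    have := mul_lt_mul_of_pos_right (Nat.ceil_lt_add_one (div_pos hh ha).le) ha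
    rwa [add_mul, div_mul_cancel₀ _ ha.ne', one_mul] at this
  have hmono := hf (show t + h ≤ t + ⌈h / a⌉₊ * a by linarith)
  nlinarith

theorem eventually_le_div_of_eventually_lt_div {f : ℝ → ℝ} (hf : Monotone f) {a c d : ℝ}
    (ha : 0 < a) (hcd : c < d) (hd : ∀ᶠ t in atTop, d < (f (t + a) - f t) / a) :
    ∀ᶠ p : ℝ × ℝ in atTop ×ˢ atTop, c ≤ (f (p.1 + p.2) - f p.1) / p.2 := by
  obtain ⟨T, hT⟩ := eventually_atTop.1 hd
  filter_upwards [(eventually_ge_atTop T).prod_mk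
    ((eventually_gt_atTop 0).and (eventually_ge_atTop (d * a / (d - c))))]
  rintro ⟨t, h⟩ ⟨ht, hh, hh'⟩
  dsimp only at ht hh hh' ⊢
  rcases le_total c 0 with hc | hc
  · exact hc.trans (div_nonneg (sub_nonneg.2 (hf (by linarith))) hh.le)
  rw [div_le_iff₀ (by linarith)] at hh'
  rw [le_div_iff₀ hh]
  have hstep : ∀ t, T ≤ t → -f (t + a) ≤ -f t + -(d * a) := fun t ht => by
    have := (lt_div_iff₀ ha).1 (hT t ht)
    linarith
  have hle := le_add_nat_mul_of_forall_ge (f := fun t => -f t) ha.le hstep ⌊h / a⌋₊ ht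
  have hfloor : ⌊h / a⌋₊ * a ≤ h := (le_div_iff₀ ha).1 (Nat.floor_le (div_pos hh ha).le)
  have hfloor' : h < (⌊h / a⌋₊ : ℝ) * a + a := by
    have := (div_lt_iff₀ ha).1 (Nat.lt_floor_add_one (h / a))
    linarith
  have hmono := hf (show t + ⌊h / a⌋₊ * a ≤ t + h by linarith)
  nlinarith

theorem limsup_prod_le_limsup {f : ℝ → ℝ} (hf : Monotone f) {a : ℝ} (ha : 0 < a) :
    limsup (fun p : ℝ × ℝ => (((f (p.1 + p.2) - f p.1) / p.2 : ℝ) : EReal)) (atTop ×ˢ atTop) ≤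
      limsup (fun t : ℝ => (((f (t + a) - f t) / a : ℝ) : EReal)) atTop := by
  refine EReal.le_of_forall_lt_iff_le.1 fun c hc => ?_
  obtain ⟨d, hd, hdc⟩ := EReal.lt_iff_exists_real_btwn.1 hc
  refine limsup_le_of_le (h := ?_)
  have := eventually_div_le_of_eventually_div_lt hf ha (EReal.coe_lt_coe_iff.1 hdc)
    ((eventually_lt_of_limsup_lt hd).mono fun t ht => EReal.coe_lt_coe_iff.1 ht)
  exact this.mono fun p hp => EReal.coe_le_coe_iff.2 hp

theorem liminf_le_liminf_prod {f : ℝ → ℝ} (hf : Monotone f) {a : ℝ} (ha : 0 < a) :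
    liminf (fun t : ℝ => (((f (t + a) - f t) / a : ℝ) : EReal)) atTop ≤
      liminf (fun p : ℝ × ℝ => (((f (p.1 + p.2) - f p.1) / p.2 : ℝ) : EReal))
        (atTop ×ˢ atTop) := by
  refine EReal.ge_of_forall_gt_iff_ge.1 fun c hc => ?_
  obtain ⟨d, hcd, hd⟩ := EReal.lt_iff_exists_real_btwn.1 hc
  refine le_liminf_of_le (h := ?_)
  have := eventually_le_div_of_eventually_lt_div hf ha (EReal.coe_lt_coe_iff.1 hcd)
    ((eventually_lt_of_lt_liminf hd).mono fun t ht => EReal.coe_lt_coe_iff.1 ht)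
  exact this.mono fun p hp => EReal.coe_le_coe_iff.2 hp

theorem eventually_limsup_lt_of_limsup_prod_lt {α β γ : Type*} [CompleteLinearOrder γ]
    [DenselyOrdered γ] {l : Filter α} {m : Filter β} {u : α × β → γ} {c : γ}
    (hc : limsup u (l ×ˢ m) < c) : ∀ᶠ b in m, limsup (fun a => u (a, b)) l < c := by
  obtain ⟨d, hd, hdc⟩ := exists_between hc
  have h := (eventually_swap_iff.1 (eventually_lt_of_limsup_lt hd)).curry
  exact h.mono fun b hb => (limsup_le_of_le (h := hb.mono fun a ha => ha.le)).trans_lt hdc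

theorem eventually_lt_liminf_of_lt_liminf_prod {α β γ : Type*} [CompleteLinearOrder γ]
    [DenselyOrdered γ] {l : Filter α} {m : Filter β} {u : α × β → γ} {c : γ}
    (hc : c < liminf u (l ×ˢ m)) : ∀ᶠ b in m, c < liminf (fun a => u (a, b)) l := by
  obtain ⟨d, hcd, hd⟩ := exists_between hc
  have h := (eventually_swap_iff.1 (eventually_lt_of_lt_liminf hd)).curry
  exact h.mono fun b hb => hcd.trans_le (le_liminf_of_le (h := hb.mono fun a ha => ha.le))

/-- Lemma 1.2 (`doublelim`): for `f` non-decreasing, right-continuous, bounded below and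
unbounded above, the limsup (resp. liminf) of `(f(t+h)-f(t))/h` along the product filter
where both `t → ∞` and `h → ∞` coincides with the iterated limit
`lim_{h→∞} limsup_{t→∞} (f(t+h)-f(t))/h` (resp. `lim_{h→∞} liminf_{t→∞} (f(t+h)-f(t))/h`). -/
theorem stmt1 (f : ℝ → ℝ) (hmono : Monotone f)
    (hrc : ∀ x : ℝ, ContinuousWithinAt f (Set.Ici x) x)
    (hbdd : BddBelow (Set.range f)) (hunbdd : ¬ BddAbove (Set.range f)) :
    ∃ Lsup Linf : EReal,
      (Tendsto (fun h : ℝ =>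
          limsup (fun t : ℝ => (((f (t + h) - f t) / h : ℝ) : EReal)) atTop)
        atTop (nhds Lsup)) ∧
      (Tendsto (fun h : ℝ =>
          liminf (fun t : ℝ => (((f (t + h) - f t) / h : ℝ) : EReal)) atTop)
        atTop (nhds Linf)) ∧
      (limsup (fun p : ℝ × ℝ => (((f (p.1 + p.2) - f p.1) / p.2 : ℝ) : EReal))
        (atTop ×ˢ atTop) = Lsup) ∧
      (liminf (fun p : ℝ × ℝ => (((f (p.1 + p.2) - f p.1) / p.2 : ℝ) : EReal))
        (atTop ×ˢ atTop) = Linf) := by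
  refine ⟨_, _, tendsto_order.2 ⟨fun c hc => ?_, fun c hc => ?_⟩,
    tendsto_order.2 ⟨fun c hc => ?_, fun c hc => ?_⟩, rfl, rfl⟩
  · exact (eventually_gt_atTop 0).mono fun h hh => hc.trans_le (limsup_prod_le_limsup hmono hh)
  · exact eventually_limsup_lt_of_limsup_prod_lt hc
  · exact eventually_lt_liminf_of_lt_liminf_prod hc
  · exact (eventually_gt_atTop 0).mono fun h hh => (liminf_le_liminf_prod hmono hh).trans_lt hc
end

section
/- Let μ ∈ M be strictly positive. Then the following four quantities in [0,+∞] coincide: (1) sup{α > 0 : limsup_{x→∞} (∫_0^x μ(t)^α dt)/log x = +∞} (taken to be 0 if the set is empty); (2) inf{α > 0 : lim_{x→∞} (∫_0^x μ(t)^α dt)/log x = 0} (taken to be +∞ if the set is empty); (3) inf{α > 0 : ∫_0^∞ μ(t)^α dt < ∞} (taken to be +∞ if the set is empty); (4) d̄(μ) := (liminf_{t→∞} log(1/μ(t))/log t)⁻¹, with the conventions 1/0 = +∞ and 1/(+∞) = 0. -/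
open Filter MeasureTheory

/-- `d̄(μ) = (liminf_{t→∞} log(1/μ(t))/log t)⁻¹`, computed in `[0,∞]` with the conventions
`1/0 = +∞` and `1/(+∞) = 0` (the conventions of `ℝ≥0∞`). -/
noncomputable def dUpF (μ : ℝ → ℝ) : ENNReal :=
  (Filter.liminf (fun x : ℝ => ENNReal.ofReal (Real.log (1 / μ x) / Real.log x))
    Filter.atTop)⁻¹

theorem sInf_ofReal_image_eq {P : ℝ → Prop} {D : ENNReal}
    (hmem : ∀ α : ℝ, 0 < α → D < ENNReal.ofReal α → P α)
    (hle : ∀ α : ℝ, 0 < α → P α → D ≤ ENNReal.ofReal α) :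
    sInf (ENNReal.ofReal '' {α : ℝ | 0 < α ∧ P α}) = D := by
  refine le_antisymm (le_of_forall_gt fun c hc => ?_) (le_sInf ?_)
  · obtain ⟨r, hDr, hrc⟩ := ENNReal.lt_iff_exists_nnreal_btwn.1 hc
    rw [← ENNReal.ofReal_coe_nnreal] at hDr hrc
    have hr : 0 < (r : ℝ) := ENNReal.ofReal_pos.1 (bot_le.trans_lt hDr)
    exact lt_of_le_of_lt (sInf_le ⟨r, ⟨hr, hmem r hr hDr⟩, rfl⟩) hrc
  · rintro _ ⟨α, ⟨h0, hP⟩, rfl⟩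
    exact hle α h0 hP

theorem sSup_ofReal_image_eq {P : ℝ → Prop} {D : ENNReal}
    (hmem : ∀ α : ℝ, 0 < α → ENNReal.ofReal α < D → P α)
    (hle : ∀ α : ℝ, 0 < α → P α → ENNReal.ofReal α ≤ D) :
    sSup (ENNReal.ofReal '' {α : ℝ | 0 < α ∧ P α}) = D := by
  refine le_antisymm (sSup_le ?_) (le_of_forall_lt fun c hc => ?_)
  · rintro _ ⟨α, ⟨h0, hP⟩, rfl⟩
    exact hle α h0 hP
  · obtain ⟨r, hcr, hrD⟩ := ENNReal.lt_iff_exists_nnreal_btwn.1 hc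
    rw [← ENNReal.ofReal_coe_nnreal] at hcr hrD
    have hr : 0 < (r : ℝ) := ENNReal.ofReal_pos.1 (bot_le.trans_lt hcr)
    exact lt_of_lt_of_le hcr (le_sSup ⟨r, ⟨hr, hmem r hr hrD⟩, rfl⟩)

theorem AntitoneOn.rpow_const_Ici {μ : ℝ → ℝ} (hpos : ∀ x : ℝ, 0 ≤ x → 0 < μ x)
    (hanti : AntitoneOn μ (Set.Ici 0)) {α : ℝ} (hα : 0 ≤ α) :
    AntitoneOn (fun t => μ t ^ α) (Set.Ici 0) := fun _ hx y hy hxy =>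
  Real.rpow_le_rpow (hpos y hy).le (hanti hx hy hxy) hα

theorem AntitoneOn.integrableOn_Ioc_of_Ici {f : ℝ → ℝ} (hf : AntitoneOn f (Set.Ici 0)) (x : ℝ) :
    IntegrableOn f (Set.Ioc 0 x) :=
  ((hf.mono Set.Icc_subset_Ici_self).integrableOn_isCompact isCompact_Icc).mono_set
    Set.Ioc_subset_Icc_self

theorem integrableOn_rpow_of_dUpF_lt {μ : ℝ → ℝ} (hpos : ∀ x : ℝ, 0 ≤ x → 0 < μ x)
    (hanti : AntitoneOn μ (Set.Ici 0)) {α : ℝ} (hα : 0 < α) (h : dUpF μ < ENNReal.ofReal α) :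
    IntegrableOn (fun t : ℝ => μ t ^ α) (Set.Ioi 0) := by
  have hf := hanti.rpow_const_Ici hpos hα.le
  rw [dUpF, ENNReal.inv_lt_iff_inv_lt] at h
  obtain ⟨s, hαs, hsL⟩ := ENNReal.lt_iff_exists_nnreal_btwn.1 h
  rw [← ENNReal.ofReal_coe_nnreal, ← ENNReal.ofReal_inv_of_pos hα] at hαs
  have hsα : 1 < (s : ℝ) * α := by
    have := (ENNReal.ofReal_lt_ofReal_iff_of_nonneg (inv_pos.2 hα).le).1 hαs
    rwa [inv_lt_iff_one_lt_mul₀ hα] at this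
  obtain ⟨A, hA⟩ := eventually_atTop.1 (eventually_lt_of_lt_liminf hsL)
  set B := max A 2 with hB
  have hB2 : 2 ≤ B := le_max_right _ _
  have hbound : ∀ t ∈ Set.Ioi B, μ t ^ α ≤ t ^ (-((s : ℝ) * α)) := by
    intro t ht
    have ht' : B < t := ht
    have ht0 : 0 < t := by linarith
    have hlog : 0 < Real.log t := Real.log_pos (by linarith)
    have hm := hpos t ht0.le
    have h1 := hA t ((le_max_left A 2).trans ht'.le)
    rw [← ENNReal.ofReal_coe_nnreal,
      ENNReal.ofReal_lt_ofReal_iff_of_nonneg s.coe_nonneg, lt_div_iff₀ hlog, one_div,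
      Real.log_inv] at h1
    rw [Real.rpow_def_of_pos hm, Real.rpow_def_of_pos ht0]
    exact Real.exp_le_exp.2 (by nlinarith)
  rw [← Set.Ioc_union_Ioi_eq_Ioi (show (0 : ℝ) ≤ B by linarith)]
  refine (hf.integrableOn_Ioc_of_Ici B).union ?_
  have hsub : Set.Ioi B ⊆ Set.Ici 0 := fun t ht => by
    have ht' : B < t := ht
    exact Set.mem_Ici.2 (by linarith)
  refine Integrable.mono' (integrableOn_Ioi_rpow_of_lt (a := -((s : ℝ) * α)) (by linarith)
    (by linarith : 0 < B)) ?_ ?_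
  · exact (aemeasurable_restrict_of_antitoneOn measurableSet_Ioi
      (hf.mono hsub)).aestronglyMeasurable
  · refine (ae_restrict_iff' measurableSet_Ioi).2 (ae_of_all _ fun t ht => ?_)
    rw [Real.norm_of_nonneg (Real.rpow_nonneg (hpos t (hsub ht)).le _)]
    exact hbound t ht

theorem tendsto_integral_div_log_of_integrableOn {f : ℝ → ℝ}
    (hf : IntegrableOn f (Set.Ioi 0)) :
    Tendsto (fun x : ℝ => (∫ t in Set.Ioc (0 : ℝ) x, f t) / Real.log x) atTop (nhds 0) := by
  refine Tendsto.div_atTop (a := ∫ t in Set.Ioi (0 : ℝ), f t) ?_ Real.tendsto_log_atTop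
  refine (intervalIntegral_tendsto_integral_Ioi 0 hf tendsto_id).congr' ?_
  filter_upwards [eventually_ge_atTop 0] with x hx
  exact intervalIntegral.integral_of_le hx

theorem limsup_coe_ne_top_of_tendsto {g : ℝ → ℝ} {a : ℝ} (hg : Tendsto g atTop (nhds a)) :
    limsup (fun x => (g x : EReal)) atTop ≠ ⊤ := by
  have h := (continuous_coe_real_ereal.tendsto a).comp hg
  exact h.limsup_eq.trans_ne (EReal.coe_ne_top a)

theorem limsup_eq_top_of_lt_dUpF {μ : ℝ → ℝ} (hpos : ∀ x : ℝ, 0 ≤ x → 0 < μ x)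
    (hanti : AntitoneOn μ (Set.Ici 0)) {α : ℝ} (hα : 0 < α) (h : ENNReal.ofReal α < dUpF μ) :
    limsup (fun x : ℝ =>
      (((∫ t in Set.Ioc (0 : ℝ) x, μ t ^ α) / Real.log x : ℝ) : EReal)) atTop = ⊤ := by
  have hf := hanti.rpow_const_Ici hpos hα.le
  rw [dUpF, ENNReal.lt_inv_iff_lt_inv] at h
  obtain ⟨s, hLs, hsα⟩ := ENNReal.lt_iff_exists_nnreal_btwn.1 h
  rw [← ENNReal.ofReal_coe_nnreal, ← ENNReal.ofReal_inv_of_pos hα] at hsα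
  have hsα1 : 0 < 1 - (s : ℝ) * α := by
    have := (ENNReal.ofReal_lt_ofReal_iff_of_nonneg s.coe_nonneg).1 hsα
    rw [← one_div, lt_div_iff₀ hα] at this
    linarith
  have hfreq := frequently_lt_of_liminf_lt (by isBoundedDefault) hLs
  have hgrow : Tendsto (fun x : ℝ => x ^ (1 - (s : ℝ) * α) / Real.log x) atTop atTop := by
    have h0 := (isLittleO_log_rpow_atTop hsα1).tendsto_div_nhds_zero
    have hpos' : ∀ᶠ x : ℝ in atTop, Real.log x / x ^ (1 - (s : ℝ) * α) ∈ Set.Ioi (0 : ℝ) := by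
      filter_upwards [eventually_gt_atTop 1] with x hx
      exact div_pos (Real.log_pos hx) (Real.rpow_pos_of_pos (by linarith) _)
    refine (tendsto_inv_nhdsGT_zero.comp (tendsto_nhdsWithin_iff.2 ⟨h0, hpos'⟩)).congr ?_
    intro x
    simp
  refine EReal.eq_top_iff_forall_lt _ |>.2 fun M => ?_
  refine lt_of_lt_of_le (EReal.coe_lt_coe_iff.2 (lt_add_one M)) ?_
  refine le_limsup_of_frequently_le ?_ (by isBoundedDefault)
  refine (hfreq.and_eventually ((hgrow.eventually_ge_atTop (M + 1)).and
    (eventually_gt_atTop 1))).mono ?_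
  rintro x ⟨h1, h2, hx⟩
  have hx0 : 0 < x := by linarith
  have hlog : 0 < Real.log x := Real.log_pos hx
  have hm := hpos x hx0.le
  refine EReal.coe_le_coe_iff.2 (h2.trans (div_le_div_of_nonneg_right ?_ hlog.le))
  have hμ : x ^ (-((s : ℝ) * α)) ≤ μ x ^ α := by
    rw [← ENNReal.ofReal_coe_nnreal] at h1
    have h3 := (ENNReal.ofReal_lt_ofReal_iff'.1 h1).1
    rw [div_lt_iff₀ hlog, one_div, Real.log_inv] at h3
    rw [Real.rpow_def_of_pos hm, Real.rpow_def_of_pos hx0]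
    exact Real.exp_le_exp.2 (by nlinarith)
  calc x ^ (1 - (s : ℝ) * α) = x * x ^ (-((s : ℝ) * α)) := by
        rw [sub_eq_add_neg, Real.rpow_add hx0, Real.rpow_one]
    _ ≤ x * μ x ^ α := by gcongr
    _ = ∫ _ in Set.Ioc (0 : ℝ) x, μ x ^ α := by simp [hx0.le]
    _ ≤ ∫ t in Set.Ioc (0 : ℝ) x, μ t ^ α :=
        setIntegral_mono_on (integrableOn_const (by simp)) (hf.integrableOn_Ioc_of_Ici x)
          measurableSet_Ioc fun t ht => hf ht.1.le hx0.le ht.2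

/-- Theorem 1.4 (`Thm:dimension`): for a strictly positive `μ ∈ M`, the quantities
`d₁ = sup{α>0 : limsup_x (∫₀ˣ μ^α)/log x = ∞}`, `d₂ = inf{α>0 : lim_x (∫₀ˣ μ^α)/log x = 0}`
and `d₃ = inf{α>0 : ∫₀^∞ μ^α < ∞}` (with `sup ∅ = 0`, `inf ∅ = +∞`) all coincide with
`d̄(μ) = (liminf_{t→∞} log(1/μ(t))/log t)⁻¹`. -/
theorem stmt2 (μ : ℝ → ℝ)
    (hpos : ∀ x : ℝ, 0 ≤ x → 0 < μ x)
    (hanti : AntitoneOn μ (Set.Ici 0))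
    (hrc : ∀ x : ℝ, 0 ≤ x → ContinuousWithinAt μ (Set.Ici x) x)
    (hlim : Tendsto μ atTop (nhds 0)) :
    (sSup (ENNReal.ofReal '' {α : ℝ | 0 < α ∧
        limsup (fun x : ℝ =>
          (((∫ t in Set.Ioc (0:ℝ) x, μ t ^ α) / Real.log x : ℝ) : EReal)) atTop = ⊤})
      = dUpF μ) ∧
    (sInf (ENNReal.ofReal '' {α : ℝ | 0 < α ∧
        Tendsto (fun x : ℝ => (∫ t in Set.Ioc (0:ℝ) x, μ t ^ α) / Real.log x)
          atTop (nhds 0)})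
      = dUpF μ) ∧
    (sInf (ENNReal.ofReal '' {α : ℝ | 0 < α ∧
        IntegrableOn (fun t : ℝ => μ t ^ α) (Set.Ioi 0)})
      = dUpF μ) := by
  have htend : ∀ α : ℝ, 0 < α → dUpF μ < ENNReal.ofReal α →
      Tendsto (fun x : ℝ => (∫ t in Set.Ioc (0:ℝ) x, μ t ^ α) / Real.log x) atTop (nhds 0) :=
    fun α hα h =>
      tendsto_integral_div_log_of_integrableOn (integrableOn_rpow_of_dUpF_lt hpos hanti hα h)
  have hle : ∀ α : ℝ, 0 < α →
      Tendsto (fun x : ℝ => (∫ t in Set.Ioc (0:ℝ) x, μ t ^ α) / Real.log x) atTop (nhds 0) →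
      dUpF μ ≤ ENNReal.ofReal α := fun α hα h => not_lt.1 fun hlt =>
    limsup_coe_ne_top_of_tendsto h (limsup_eq_top_of_lt_dUpF hpos hanti hα hlt)
  refine ⟨sSup_ofReal_image_eq (fun α hα h => limsup_eq_top_of_lt_dUpF hpos hanti hα h)
    fun α hα h => not_lt.1 fun hlt => limsup_coe_ne_top_of_tendsto (htend α hα hlt) h,
    sInf_ofReal_image_eq htend hle,
    sInf_ofReal_image_eq (fun α hα h => integrableOn_rpow_of_dUpF_lt hpos hanti hα h)
      fun α hα h => hle α hα (tendsto_integral_div_log_of_integrableOn h)⟩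
end

section
/- Let μ ∈ M be strictly positive and let γ > 0. If μ^γ (the pointwise γ-th power of μ) is eccentric, then δ̲(μ) ≤ γ ≤ δ̄(μ). -/
open Filter MeasureTheory
open scoped Classical

/-- `(1/log l)·limsup_{x→∞} log(μ(x)/μ(l·x))`, as an element of `[0,∞]`. -/
noncomputable def ratioSup (μ : ℝ → ℝ) (l : ℝ) : ENNReal :=
  Filter.limsup (fun x : ℝ => ENNReal.ofReal (Real.log (μ x / μ (l * x)) / Real.log l))
    Filter.atTop

/-- `(1/log l)·liminf_{x→∞} log(μ(x)/μ(l·x))`, as an element of `[0,∞]`. -/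
noncomputable def ratioInf (μ : ℝ → ℝ) (l : ℝ) : ENNReal :=
  Filter.liminf (fun x : ℝ => ENNReal.ofReal (Real.log (μ x / μ (l * x)) / Real.log l))
    Filter.atTop

/-- `d = δ̲(μ)`, i.e. `d = (lim_{l→∞} (1/log l)·limsup_{x→∞} log(μ(x)/μ(l·x)))⁻¹`,
with the conventions `1/0 = +∞`, `1/(+∞) = 0` (those of `ℝ≥0∞`). -/
def IsDeltaLow (μ : ℝ → ℝ) (d : ENNReal) : Prop :=
  ∃ D : ENNReal, d = D⁻¹ ∧ Filter.Tendsto (ratioSup μ) Filter.atTop (nhds D)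

/-- `d = δ̄(μ)`, i.e. `d = (lim_{l→∞} (1/log l)·liminf_{x→∞} log(μ(x)/μ(l·x)))⁻¹`. -/
def IsDeltaUp (μ : ℝ → ℝ) (d : ENNReal) : Prop :=
  ∃ D : ENNReal, d = D⁻¹ ∧ Filter.Tendsto (ratioInf μ) Filter.atTop (nhds D)

/-- The integral function `S_μ`: `S_μ(x) = ∫_x^∞ μ` if `μ` is integrable on `(0,∞)`,
and `S_μ(x) = ∫_0^x μ` otherwise. -/
noncomputable def Sfun (μ : ℝ → ℝ) (x : ℝ) : ℝ :=
  if IntegrableOn μ (Set.Ioi (0:ℝ)) then ∫ t in Set.Ioi x, μ t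
  else ∫ t in Set.Ioc (0:ℝ) x, μ t

/-- `μ` is eccentric if for some `l > 1`, `1` is a limit point as `x → ∞`
of `x ↦ S_μ(l·x)/S_μ(x)`. -/
def Eccentric (μ : ℝ → ℝ) : Prop :=
  ∃ l : ℝ, 1 < l ∧ MapClusterPt (1:ℝ) Filter.atTop (fun x => Sfun μ (l * x) / Sfun μ x)

section IntegralEstimates

variable {f : ℝ → ℝ}

lemma intervalIntegrable_of_antitoneOn_Ici (hanti : AntitoneOn f (Set.Ici 0)) {a b : ℝ}
    (ha : 0 ≤ a) (hb : 0 ≤ b) : IntervalIntegrable f volume a b := by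
  apply AntitoneOn.intervalIntegrable
  refine hanti.mono fun x hx => ?_
  rw [Set.mem_uIcc] at hx
  rcases hx with h | h
  · exact ha.trans h.1
  · exact hb.trans h.1

lemma intervalIntegrable_comp_mul_left_of_antitoneOn_Ici (hanti : AntitoneOn f (Set.Ici 0))
    {l a b : ℝ} (hl : 0 < l) (ha : 0 ≤ a) (hb : 0 ≤ b) :
    IntervalIntegrable (fun t => f (l * t)) volume a b := by
  refine intervalIntegrable_of_antitoneOn_Ici (fun x hx y hy hxy => ?_) ha hb
  exact hanti (mul_nonneg hl.le hx) (mul_nonneg hl.le hy) (mul_le_mul_of_nonneg_left hxy hl.le)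

lemma sfun_of_integrableOn (hfi : IntegrableOn f (Set.Ioi 0)) (x : ℝ) :
    Sfun f x = ∫ t in Set.Ioi x, f t := by
  simp [Sfun, hfi]

lemma sfun_of_not_integrableOn (hfi : ¬ IntegrableOn f (Set.Ioi 0)) {x : ℝ} (hx : 0 ≤ x) :
    Sfun f x = ∫ t in (0:ℝ)..x, f t := by
  simp [Sfun, hfi, intervalIntegral.integral_of_le hx]

lemma sfun_sub_sfun_of_integrableOn (hfi : IntegrableOn f (Set.Ioi 0)) {x y : ℝ} (hx : 0 ≤ x)
    (hy : 0 ≤ y) : Sfun f x - Sfun f y = ∫ t in x..y, f t := by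
  rw [sfun_of_integrableOn hfi, sfun_of_integrableOn hfi]
  exact intervalIntegral.integral_Ioi_sub_Ioi' (hfi.mono_set (Set.Ioi_subset_Ioi hx))
    (hfi.mono_set (Set.Ioi_subset_Ioi hy))

lemma sfun_sub_sfun_of_not_integrableOn (hanti : AntitoneOn f (Set.Ici 0))
    (hfi : ¬ IntegrableOn f (Set.Ioi 0)) {x y : ℝ} (hx : 0 ≤ x) (hy : 0 ≤ y) :
    Sfun f y - Sfun f x = ∫ t in x..y, f t := by
  rw [sfun_of_not_integrableOn hfi hx, sfun_of_not_integrableOn hfi hy]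
  exact intervalIntegral.integral_interval_sub_left
    (intervalIntegrable_of_antitoneOn_Ici hanti le_rfl hy)
    (intervalIntegrable_of_antitoneOn_Ici hanti le_rfl hx)

lemma abs_sfun_sub_sfun (hpos : ∀ x, 0 ≤ x → 0 < f x) (hanti : AntitoneOn f (Set.Ici 0))
    {x y : ℝ} (hx : 0 ≤ x) (hxy : x ≤ y) : |Sfun f y - Sfun f x| = ∫ t in x..y, f t := by
  have h0 : 0 ≤ ∫ t in x..y, f t :=
    intervalIntegral.integral_nonneg hxy fun t ht => (hpos t (hx.trans ht.1)).le
  by_cases hfi : IntegrableOn f (Set.Ioi 0)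
  · rw [abs_sub_comm, sfun_sub_sfun_of_integrableOn hfi hx (hx.trans hxy), abs_of_nonneg h0]
  · rw [sfun_sub_sfun_of_not_integrableOn hanti hfi hx (hx.trans hxy), abs_of_nonneg h0]

lemma intervalIntegral_pos_of_antitoneOn_Ici (hpos : ∀ x, 0 ≤ x → 0 < f x)
    (hanti : AntitoneOn f (Set.Ici 0)) {x y : ℝ} (hx : 0 ≤ x) (hxy : x < y) :
    0 < ∫ t in x..y, f t :=
  intervalIntegral.intervalIntegral_pos_of_pos_on
    (intervalIntegrable_of_antitoneOn_Ici hanti hx (hx.trans hxy.le))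
    (fun t ht => hpos t (hx.trans ht.1.le)) hxy

lemma sfun_pos (hpos : ∀ x, 0 ≤ x → 0 < f x) (hanti : AntitoneOn f (Set.Ici 0))
    {x : ℝ} (hx : 0 < x) : 0 < Sfun f x := by
  by_cases hfi : IntegrableOn f (Set.Ioi 0)
  · have h1 := sfun_sub_sfun_of_integrableOn hfi hx.le (y := x + 1) (by linarith)
    have h2 := intervalIntegral_pos_of_antitoneOn_Ici hpos hanti hx.le (lt_add_one x)
    have h3 : 0 ≤ Sfun f (x + 1) := by
      rw [sfun_of_integrableOn hfi]
      refine setIntegral_nonneg measurableSet_Ioi fun t ht => (hpos t ?_).le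
      have := Set.mem_Ioi.1 ht
      linarith
    linarith
  · rw [sfun_of_not_integrableOn hfi hx.le]
    exact intervalIntegral_pos_of_antitoneOn_Ici hpos hanti le_rfl hx

lemma sub_one_mul_integral_le (hanti : AntitoneOn f (Set.Ici 0)) {l L x : ℝ} (hl : 1 < l)
    (hL : l ≤ L) (hx : 0 ≤ x) :
    (l - 1) * ∫ t in x..L * x, f t ≤ (L - 1) * ∫ t in x..l * x, f t := by
  have hxl : x ≤ l * x := le_mul_of_one_le_left hx hl.le
  have hlL : l * x ≤ L * x := mul_le_mul_of_nonneg_right hL hx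
  have hlx : 0 ≤ l * x := hx.trans hxl
  have hA := intervalIntegrable_of_antitoneOn_Ici hanti hx hlx
  have hB := intervalIntegrable_of_antitoneOn_Ici hanti hlx (hlx.trans hlL)
  have h1 : (l * x - x) * f (l * x) ≤ ∫ t in x..l * x, f t := by
    have := intervalIntegral.integral_mono_on hxl
      (intervalIntegrable_const (c := f (l * x))) hA
      fun t ht => hanti (hx.trans ht.1) hlx ht.2
    simpa using this
  have h2 : ∫ t in l * x..L * x, f t ≤ (L * x - l * x) * f (l * x) := by
    have := intervalIntegral.integral_mono_on hlL hB
      (intervalIntegrable_const (c := f (l * x)))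
      fun t ht => hanti hlx (hlx.trans ht.1) ht.1
    simpa using this
  rw [← intervalIntegral.integral_add_adjacent_intervals hA hB]
  have h3 := mul_le_mul_of_nonneg_left h1 (sub_nonneg.2 hL)
  have h4 := mul_le_mul_of_nonneg_left h2 (sub_nonneg.2 hl.le)
  nlinarith

/-- Eccentricity holds at every scale: the parameter `L` can be chosen freely. -/
lemma Eccentric.frequently_integral_le (hecc : Eccentric f) (hpos : ∀ x, 0 ≤ x → 0 < f x)
    (hanti : AntitoneOn f (Set.Ici 0)) {L ε : ℝ} (hL : 1 < L) (hε : 0 < ε) :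
    ∃ᶠ x in atTop, ∫ t in x..L * x, f t ≤ ε * Sfun f x := by
  obtain ⟨l, hl, hcl⟩ := hecc
  set M := max l L
  have hlM : l ≤ M := le_max_left _ _
  have hM : 0 < M - 1 := by linarith
  have hl' : 0 < l - 1 := by linarith
  have hδ : 0 < ε * (l - 1) / (M - 1) := by positivity
  have hfr := mapClusterPt_iff_frequently.1 hcl _ (Metric.ball_mem_nhds 1 hδ)
  refine (hfr.and_eventually (eventually_gt_atTop 0)).mono ?_
  rintro x ⟨hx, hx0⟩
  have hS := sfun_pos hpos hanti hx0
  have hxl : x ≤ l * x := le_mul_of_one_le_left hx0.le hl.le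
  rw [Metric.mem_ball, Real.dist_eq, div_sub_one hS.ne', abs_div, abs_of_pos hS,
    div_lt_iff₀ hS, abs_sfun_sub_sfun hpos hanti hx0.le hxl] at hx
  have h1 := sub_one_mul_integral_le hanti hl hlM hx0.le
  have h2 : ∫ t in x..L * x, f t ≤ ∫ t in x..M * x, f t := by
    refine intervalIntegral.integral_mono_interval le_rfl
      (le_mul_of_one_le_left hx0.le hL.le)
      (mul_le_mul_of_nonneg_right (le_max_right _ _) hx0.le) ?_
      (intervalIntegrable_of_antitoneOn_Ici hanti hx0.le (by positivity))
    filter_upwards [ae_restrict_mem measurableSet_Ioc] with t ht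
    exact (hpos t (hx0.le.trans ht.1.le)).le
  have h3 : (M - 1) * ∫ t in x..l * x, f t < (M - 1) * (ε * (l - 1) / (M - 1) * Sfun f x) :=
    mul_lt_mul_of_pos_left hx hM
  have h4 : (M - 1) * (ε * (l - 1) / (M - 1) * Sfun f x) = (l - 1) * (ε * Sfun f x) := by
    field_simp
  exact h2.trans (le_of_mul_le_mul_left ((h1.trans h3.le).trans h4.le) hl')

lemma integrableOn_Ioi_of_intervalIntegral_le (hpos : ∀ x, 0 ≤ x → 0 < f x)
    (hanti : AntitoneOn f (Set.Ici 0)) {C : ℝ} (hC : ∀ᶠ x in atTop, ∫ t in (0:ℝ)..x, f t ≤ C) :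
    IntegrableOn f (Set.Ioi 0) := by
  refine integrableOn_Ioi_of_intervalIntegral_norm_bounded C 0 (l := atTop) (b := fun x : ℝ => x)
    (fun x => ?_) tendsto_id ?_
  · rcases le_total 0 x with h | h
    · exact (intervalIntegrable_iff_integrableOn_Ioc_of_le h).1
        (intervalIntegrable_of_antitoneOn_Ici hanti le_rfl h)
    · simp [Set.Ioc_eq_empty_of_le h]
  · filter_upwards [hC, eventually_ge_atTop 0] with x hx hx0
    refine le_of_eq_of_le (intervalIntegral.integral_congr fun t ht => ?_) hx
    rw [Set.uIcc_of_le hx0] at ht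
    exact Real.norm_of_nonneg (hpos t ht.1).le

lemma tendsto_sfun_atTop_of_not_integrableOn (hpos : ∀ x, 0 ≤ x → 0 < f x)
    (hanti : AntitoneOn f (Set.Ici 0)) (hfi : ¬ IntegrableOn f (Set.Ioi 0)) :
    Tendsto (Sfun f) atTop atTop := by
  rw [tendsto_atTop]
  intro C
  have hfr : ∃ᶠ x in atTop, C < ∫ t in (0:ℝ)..x, f t := by
    intro h
    exact hfi (integrableOn_Ioi_of_intervalIntegral_le hpos hanti (h.mono fun x hx => not_lt.1 hx))
  obtain ⟨y, hy, hy0⟩ := (hfr.and_eventually (eventually_ge_atTop 0)).exists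
  filter_upwards [eventually_ge_atTop y] with x hx
  have h1 := sfun_sub_sfun_of_not_integrableOn hanti hfi hy0 (hy0.trans hx)
  have h2 : 0 ≤ ∫ t in y..x, f t :=
    intervalIntegral.integral_nonneg hx fun t ht => (hpos t (hy0.trans ht.1)).le
  rw [← sfun_of_not_integrableOn hfi hy0] at hy
  linarith

lemma integrableOn_Ioi_comp_mul_left (hfi : IntegrableOn f (Set.Ioi 0)) {l x : ℝ} (hl : 0 < l)
    (hx : 0 ≤ x) : IntegrableOn (fun t => f (l * t)) (Set.Ioi x) :=
  (integrableOn_Ioi_comp_mul_left_iff f x hl).2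
    (hfi.mono_set (Set.Ioi_subset_Ioi (by positivity)))

lemma sfun_mul_of_integrableOn (hfi : IntegrableOn f (Set.Ioi 0)) {l : ℝ} (hl : 0 < l) (x : ℝ) :
    Sfun f (l * x) = ∫ t in Set.Ioi x, l * f (l * t) := by
  rw [sfun_of_integrableOn hfi, integral_const_mul, integral_comp_mul_left_Ioi f x hl,
    smul_eq_mul, mul_inv_cancel_left₀ hl.ne']

/-- If `l f(l x) ≥ q f(x)` for large `x`, with `q > 1`, then `f` is not eccentric. -/
lemma not_eccentric_of_le_mul (hpos : ∀ x, 0 ≤ x → 0 < f x) (hanti : AntitoneOn f (Set.Ici 0))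
    {l q : ℝ} (hl : 1 < l) (hq : 1 < q) (h : ∀ᶠ x in atTop, q * f x ≤ l * f (l * x)) :
    ¬ Eccentric f := by
  intro hecc
  obtain ⟨X, hX⟩ := eventually_atTop.1 (h.and (eventually_gt_atTop 0))
  have hX0 : 0 < X := (hX X le_rfl).2
  have hl0 : 0 < l := by linarith
  by_cases hfi : IntegrableOn f (Set.Ioi 0)
  · have h1 : q * Sfun f X ≤ Sfun f (l * X) := by
      rw [sfun_mul_of_integrableOn hfi hl0, sfun_of_integrableOn hfi, ← integral_const_mul]
      refine setIntegral_mono_on ((hfi.mono_set (Set.Ioi_subset_Ioi hX0.le)).const_mul q)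
        ((integrableOn_Ioi_comp_mul_left hfi hl0 hX0.le).const_mul l) measurableSet_Ioi ?_
      exact fun t ht => (hX t (le_of_lt ht)).1
    have h2 := sfun_pos hpos hanti hX0
    have h3 := sfun_sub_sfun_of_integrableOn hfi hX0.le (y := l * X) (by positivity)
    have h4 := intervalIntegral_pos_of_antitoneOn_Ici hpos hanti hX0.le
      (lt_mul_of_one_lt_left hX0 hl)
    nlinarith
  · have hfr := hecc.frequently_integral_le hpos hanti hl (ε := (q - 1) / 2) (by linarith)
    obtain ⟨x, ⟨hx, hxX⟩, hxS⟩ := ((hfr.and_eventually (eventually_ge_atTop X)).and_eventually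
      ((tendsto_sfun_atTop_of_not_integrableOn hpos hanti hfi).eventually_gt_atTop
        (2 * q * Sfun f X / (q - 1)))).exists
    rw [div_lt_iff₀ (by linarith)] at hxS
    have hx0 : 0 < x := hX0.trans_le hxX
    rw [← sfun_sub_sfun_of_not_integrableOn hanti hfi hx0.le (by positivity)] at hx
    have h1 : q * (Sfun f x - Sfun f X) ≤ Sfun f (l * x) - Sfun f (l * X) := by
      rw [sfun_sub_sfun_of_not_integrableOn hanti hfi hX0.le hx0.le,
        sfun_sub_sfun_of_not_integrableOn hanti hfi (by positivity) (by positivity),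
        ← intervalIntegral.mul_integral_comp_mul_left, ← intervalIntegral.integral_const_mul,
        ← intervalIntegral.integral_const_mul]
      refine intervalIntegral.integral_mono_on hxX
        ((intervalIntegrable_of_antitoneOn_Ici hanti hX0.le hx0.le).const_mul q)
        ((intervalIntegrable_comp_mul_left_of_antitoneOn_Ici hanti hl0 hX0.le hx0.le).const_mul l)
        fun t ht => (hX t ht.1).1
    have h2 := sfun_pos hpos hanti (mul_pos hl0 hX0)
    linarith

/-- If `l f(l x) ≤ q f(x)` for large `x`, with `q < 1`, then `f` is not eccentric. -/
lemma not_eccentric_of_mul_le (hpos : ∀ x, 0 ≤ x → 0 < f x) (hanti : AntitoneOn f (Set.Ici 0))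
    {l q : ℝ} (hl : 1 < l) (hq : q < 1) (h : ∀ᶠ x in atTop, l * f (l * x) ≤ q * f x) :
    ¬ Eccentric f := by
  intro hecc
  obtain ⟨X, hX⟩ := eventually_atTop.1 (h.and (eventually_gt_atTop 0))
  have hX0 : 0 < X := (hX X le_rfl).2
  have hl0 : 0 < l := by linarith
  have hq0 : 0 < q := by
    have h1 := (hX X le_rfl).1
    have h2 := mul_pos hl0 (hpos (l * X) (by positivity))
    exact pos_of_mul_pos_left (h2.trans_le h1) (hpos X hX0.le).le
  have hfi : IntegrableOn f (Set.Ioi 0) := by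
    by_contra hfi
    obtain ⟨x, hxS, hxX⟩ :=
      (((tendsto_sfun_atTop_of_not_integrableOn hpos hanti hfi).eventually_gt_atTop
        (Sfun f (l * X) / (1 - q))).and (eventually_ge_atTop X)).exists
    rw [div_lt_iff₀ (by linarith)] at hxS
    have hx0 : 0 < x := hX0.trans_le hxX
    have h1 : Sfun f (l * x) - Sfun f (l * X) ≤ q * (Sfun f x - Sfun f X) := by
      rw [sfun_sub_sfun_of_not_integrableOn hanti hfi hX0.le hx0.le,
        sfun_sub_sfun_of_not_integrableOn hanti hfi (by positivity) (by positivity),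
        ← intervalIntegral.mul_integral_comp_mul_left, ← intervalIntegral.integral_const_mul,
        ← intervalIntegral.integral_const_mul]
      refine intervalIntegral.integral_mono_on hxX
        ((intervalIntegrable_comp_mul_left_of_antitoneOn_Ici hanti hl0 hX0.le hx0.le).const_mul l)
        ((intervalIntegrable_of_antitoneOn_Ici hanti hX0.le hx0.le).const_mul q)
        fun t ht => (hX t ht.1).1
    have h2 := mul_pos hq0 (sfun_pos hpos hanti hX0)
    have h3 := sfun_sub_sfun_of_not_integrableOn hanti hfi hx0.le (y := l * x) (by positivity)
    have h4 := intervalIntegral_pos_of_antitoneOn_Ici hpos hanti hx0.le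
      (lt_mul_of_one_lt_left hx0 hl)
    linarith
  have hfr := hecc.frequently_integral_le hpos hanti hl (ε := (1 - q) / 2) (by linarith)
  obtain ⟨x, hx, hxX⟩ := (hfr.and_eventually (eventually_ge_atTop X)).exists
  have hx0 : 0 < x := hX0.trans_le hxX
  have h1 : Sfun f (l * x) ≤ q * Sfun f x := by
    rw [sfun_mul_of_integrableOn hfi hl0, sfun_of_integrableOn hfi, ← integral_const_mul]
    refine setIntegral_mono_on ((integrableOn_Ioi_comp_mul_left hfi hl0 hx0.le).const_mul l)
      ((hfi.mono_set (Set.Ioi_subset_Ioi hx0.le)).const_mul q) measurableSet_Ioi ?_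
    exact fun t ht => (hX t (hxX.trans (le_of_lt ht))).1
  rw [← sfun_sub_sfun_of_integrableOn hfi hx0.le (by positivity)] at hx
  have h2 := sfun_pos hpos hanti hx0
  nlinarith

end IntegralEstimates

lemma rpow_one_sub_mul_rpow_le_iff {a b l s γ : ℝ} (ha : 0 < a) (hb : 0 < b) (hl : 1 < l)
    (hγ : 0 < γ) :
    l ^ (1 - s * γ) * a ^ γ ≤ l * b ^ γ ↔ Real.log (a / b) / Real.log l ≤ s := by
  have hl0 : 0 < l := by linarith
  rw [← Real.log_le_log_iff (by positivity) (by positivity),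
    Real.log_mul (by positivity) (by positivity), Real.log_mul (by positivity) (by positivity),
    Real.log_rpow hl0, Real.log_rpow ha, Real.log_rpow hb, div_le_iff₀ (Real.log_pos hl),
    Real.log_div ha.ne' hb.ne']
  exact ⟨fun h => le_of_mul_le_mul_left (by linarith) hγ,
    fun h => by nlinarith [mul_le_mul_of_nonneg_left h hγ.le]⟩

lemma mul_rpow_le_rpow_one_sub_iff {a b l s γ : ℝ} (ha : 0 < a) (hb : 0 < b) (hl : 1 < l)
    (hγ : 0 < γ) :
    l * b ^ γ ≤ l ^ (1 - s * γ) * a ^ γ ↔ s ≤ Real.log (a / b) / Real.log l := by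
  have hl0 : 0 < l := by linarith
  rw [← Real.log_le_log_iff (by positivity) (by positivity),
    Real.log_mul (by positivity) (by positivity), Real.log_mul (by positivity) (by positivity),
    Real.log_rpow hl0, Real.log_rpow ha, Real.log_rpow hb, le_div_iff₀ (Real.log_pos hl),
    Real.log_div ha.ne' hb.ne']
  exact ⟨fun h => le_of_mul_le_mul_left (by linarith) hγ,
    fun h => by nlinarith [mul_le_mul_of_nonneg_left h hγ.le]⟩

/-- Theorem 1.5 (`Thm:subcsupc`): if `μ ∈ M` is strictly positive, `γ > 0` and `μ^γ` is
eccentric, then `δ̲(μ) ≤ γ ≤ δ̄(μ)`. -/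
theorem stmt3 (μ : ℝ → ℝ)
    (hpos : ∀ x : ℝ, 0 ≤ x → 0 < μ x)
    (hanti : AntitoneOn μ (Set.Ici 0))
    (hrc : ∀ x : ℝ, 0 ≤ x → ContinuousWithinAt μ (Set.Ici x) x)
    (hlim : Tendsto μ atTop (nhds 0))
    (γ : ℝ) (hγ : 0 < γ)
    (hecc : Eccentric (fun x => μ x ^ γ))
    (dlow dup : ENNReal) (hdlow : IsDeltaLow μ dlow) (hdup : IsDeltaUp μ dup) :
    dlow ≤ ENNReal.ofReal γ ∧ ENNReal.ofReal γ ≤ dup := by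
  have hpos' : ∀ x : ℝ, 0 ≤ x → 0 < μ x ^ γ := fun x hx => Real.rpow_pos_of_pos (hpos x hx) γ
  have hanti' : AntitoneOn (fun x => μ x ^ γ) (Set.Ici 0) := fun x hx y hy hxy =>
    Real.rpow_le_rpow (hpos y hy).le (hanti hx hy hxy) hγ.le
  constructor
  · obtain ⟨D, rfl, hD⟩ := hdlow
    by_contra! hlt
    rw [ENNReal.lt_inv_iff_lt_inv, ← ENNReal.ofReal_inv_of_pos hγ] at hlt
    obtain ⟨s, hs0, hDs, hsγ⟩ := ENNReal.lt_iff_exists_real_btwn.1 hlt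
    have hsγ' : s * γ < 1 := by
      rw [ENNReal.ofReal_lt_ofReal_iff (by positivity)] at hsγ
      calc s * γ < γ⁻¹ * γ := mul_lt_mul_of_pos_right hsγ hγ
        _ = 1 := inv_mul_cancel₀ hγ.ne'
    obtain ⟨l, hlim_lt, hl⟩ :=
      ((hD.eventually_lt_const hDs).and (eventually_gt_atTop 1)).exists
    refine not_eccentric_of_le_mul hpos' hanti' hl
      (Real.one_lt_rpow hl (sub_pos.2 hsγ')) ?_ hecc
    filter_upwards [eventually_lt_of_limsup_lt hlim_lt, eventually_ge_atTop 0] with x hx hx0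
    refine (rpow_one_sub_mul_rpow_le_iff (hpos x hx0) (hpos _ (by positivity)) hl hγ).2 ?_
    exact (ENNReal.ofReal_le_ofReal_iff hs0).1 hx.le
  · obtain ⟨D, rfl, hD⟩ := hdup
    by_contra! hlt
    rw [ENNReal.inv_lt_iff_inv_lt, ← ENNReal.ofReal_inv_of_pos hγ] at hlt
    obtain ⟨s, hs0, hγs, hsD⟩ := ENNReal.lt_iff_exists_real_btwn.1 hlt
    have hsγ' : 1 < s * γ := by
      rw [ENNReal.ofReal_lt_ofReal_iff_of_nonneg (by positivity)] at hγs
      rwa [inv_lt_iff_one_lt_mul₀ hγ] at hγs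
    obtain ⟨l, hlim_lt, hl⟩ :=
      ((hD.eventually_const_lt hsD).and (eventually_gt_atTop 1)).exists
    refine not_eccentric_of_mul_le hpos' hanti' hl
      (Real.rpow_lt_one_of_one_lt_of_neg hl (sub_neg.2 hsγ')) ?_ hecc
    filter_upwards [eventually_lt_of_lt_liminf hlim_lt, eventually_ge_atTop 0] with x hx hx0
    refine (mul_rpow_le_rpow_one_sub_iff (hpos x hx0) (hpos _ (by positivity)) hl hγ).2 ?_
    exact (ENNReal.ofReal_lt_ofReal_iff'.1 hx).1.le
end

section
/- Let μ ∈ M be strictly positive. Then 1 is a limit point, as x → ∞, of the function x ↦ S_μ(x)/S_μ(2x) if and only if liminf_{x→∞} x·μ(x)/S_μ(x) = 0. -/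
open Filter MeasureTheory
open scoped Classical

theorem AntitoneOn.integrableOn_Ioc_of_nonneg {μ : ℝ → ℝ} (hanti : AntitoneOn μ (Set.Ici 0))
    {a b : ℝ} (ha : 0 ≤ a) : IntegrableOn μ (Set.Ioc a b) :=
  ((hanti.mono fun _ hx => ha.trans hx.1).integrableOn_isCompact
    (isCompact_Icc (a := a) (b := b))).mono_set Set.Ioc_subset_Icc_self

theorem AntitoneOn.mul_le_setIntegral_Ioc {μ : ℝ → ℝ} (hanti : AntitoneOn μ (Set.Ici 0))
    {a b : ℝ} (ha : 0 ≤ a) (hab : a ≤ b) :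
    (b - a) * μ b ≤ ∫ t in Set.Ioc a b, μ t := by
  have h := setIntegral_mono_on (μ := volume) (s := Set.Ioc a b) (f := fun _ => μ b) (g := μ)
    (by simp) (hanti.integrableOn_Ioc_of_nonneg ha) measurableSet_Ioc
    fun t ht => hanti (ha.trans ht.1.le) (ha.trans hab) ht.2
  simpa [hab] using h

theorem AntitoneOn.setIntegral_Ioc_le_mul {μ : ℝ → ℝ} (hanti : AntitoneOn μ (Set.Ici 0))
    {a b : ℝ} (ha : 0 ≤ a) (hab : a ≤ b) :
    ∫ t in Set.Ioc a b, μ t ≤ (b - a) * μ a := by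
  have h := setIntegral_mono_on (μ := volume) (s := Set.Ioc a b) (f := μ) (g := fun _ => μ a)
    (hanti.integrableOn_Ioc_of_nonneg ha) (by simp) measurableSet_Ioc
    fun t ht => hanti ha (ha.trans ht.1.le) ht.1.le
  simpa [hab] using h

theorem Sfun_pos {μ : ℝ → ℝ} (hpos : ∀ x : ℝ, 0 ≤ x → 0 < μ x)
    (hanti : AntitoneOn μ (Set.Ici 0)) {x : ℝ} (hx : 0 < x) : 0 < Sfun μ x := by
  unfold Sfun
  split_ifs with hi
  · have h := hanti.mul_le_setIntegral_Ioc hx.le (by linarith : x ≤ x + 1)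
    have hm : ∫ t in Set.Ioc x (x + 1), μ t ≤ ∫ t in Set.Ioi x, μ t :=
      setIntegral_mono_set (hi.mono_set (Set.Ioi_subset_Ioi hx.le))
        ((ae_restrict_mem measurableSet_Ioi).mono fun t ht => (hpos t (hx.le.trans ht.le)).le)
        Set.Ioc_subset_Ioi_self.eventuallyLE
    have := hpos (x + 1) (by linarith)
    linarith
  · have h := hanti.mul_le_setIntegral_Ioc le_rfl hx.le
    have := mul_pos hx (hpos x hx.le)
    rw [sub_zero] at h
    linarith

theorem abs_Sfun_sub_Sfun {μ : ℝ → ℝ} (hpos : ∀ x : ℝ, 0 ≤ x → 0 < μ x)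
    (hanti : AntitoneOn μ (Set.Ici 0)) {a b : ℝ} (ha : 0 ≤ a) (hab : a ≤ b) :
    |Sfun μ a - Sfun μ b| = ∫ t in Set.Ioc a b, μ t := by
  have h0 : 0 ≤ ∫ t in Set.Ioc a b, μ t :=
    setIntegral_nonneg measurableSet_Ioc fun t ht => (hpos t (ha.trans ht.1.le)).le
  unfold Sfun
  split_ifs with hi
  · rw [← Set.Ioc_union_Ioi_eq_Ioi hab, setIntegral_union
      (Set.Ioc_disjoint_Ioi le_rfl) measurableSet_Ioi (hanti.integrableOn_Ioc_of_nonneg ha)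
      (hi.mono_set (Set.Ioi_subset_Ioi (ha.trans hab))), add_sub_cancel_right, abs_of_nonneg h0]
  · rw [← Set.Ioc_union_Ioc_eq_Ioc ha hab, setIntegral_union
      (Set.Ioc_disjoint_Ioc_of_le le_rfl) measurableSet_Ioc
      (hanti.integrableOn_Ioc_of_nonneg le_rfl) (hanti.integrableOn_Ioc_of_nonneg ha),
      sub_add_cancel_left, abs_neg, abs_of_nonneg h0]

theorem liminf_ofReal_eq_zero_iff {α : Type*} {l : Filter α} {f : α → ℝ} :
    liminf (fun x => ENNReal.ofReal (f x)) l = 0 ↔ ∀ ε > 0, ∃ᶠ x in l, f x < ε := by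
  constructor
  · intro h ε hε
    have hlt : liminf (fun x => ENNReal.ofReal (f x)) l < ENNReal.ofReal ε := by
      rw [h]; exact ENNReal.ofReal_pos.2 hε
    exact (frequently_lt_of_liminf_lt (by isBoundedDefault) hlt).mono fun x hx =>
      (ENNReal.ofReal_lt_ofReal_iff hε).1 hx
  · intro h
    refine nonpos_iff_eq_zero.1 (ENNReal.le_of_forall_pos_le_add fun ε hε _ => ?_)
    rw [zero_add]
    refine liminf_le_of_frequently_le ((h ε hε).mono fun x hx => ?_) (by isBoundedDefault)
    exact (ENNReal.ofReal_le_ofReal hx.le).trans (by simp)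

/-- Proposition 1.6: for a strictly positive `μ ∈ M`, `1` is a limit point, as `x → ∞`,
of `x ↦ S_μ(x)/S_μ(2x)` if and only if `liminf_{x→∞} x·μ(x)/S_μ(x) = 0`
(the liminf being computed in `[0,∞]`). -/
theorem stmt4 (μ : ℝ → ℝ)
    (hpos : ∀ x : ℝ, 0 ≤ x → 0 < μ x)
    (hanti : AntitoneOn μ (Set.Ici 0))
    (hrc : ∀ x : ℝ, 0 ≤ x → ContinuousWithinAt μ (Set.Ici x) x)
    (hlim : Tendsto μ atTop (nhds 0)) :
    MapClusterPt (1:ℝ) atTop (fun x => Sfun μ x / Sfun μ (2 * x)) ↔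
      Filter.liminf (fun x : ℝ => ENNReal.ofReal (x * μ x / Sfun μ x)) Filter.atTop = 0 := by
  have key : ∀ x : ℝ, 0 < x → x * μ (2 * x) ≤ |Sfun μ x - Sfun μ (2 * x)| ∧
      |Sfun μ x - Sfun μ (2 * x)| ≤ x * μ x := by
    intro x hx
    have hle : x ≤ 2 * x := by linarith
    have hsub : 2 * x - x = x := by ring
    have h₁ := hanti.mul_le_setIntegral_Ioc hx.le hle
    have h₂ := hanti.setIntegral_Ioc_le_mul hx.le hle
    rw [hsub] at h₁ h₂
    rw [abs_Sfun_sub_Sfun hpos hanti hx.le hle]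
    exact ⟨h₁, h₂⟩
  rw [liminf_ofReal_eq_zero_iff, mapClusterPt_iff_frequently]
  constructor
  · intro h ε hε
    have hf := (h _ (Metric.ball_mem_nhds 1 (half_pos hε))).and_eventually (eventually_gt_atTop 0)
    refine (tendsto_id.const_mul_atTop (two_pos (α := ℝ))).frequently (hf.mono ?_)
    rintro x ⟨hb, hx⟩
    have hS := Sfun_pos hpos hanti (by linarith : 0 < 2 * x)
    rw [Metric.mem_ball, Real.dist_eq, div_sub_one hS.ne', abs_div, abs_of_pos hS,
      div_lt_iff₀ hS] at hb
    rw [id, div_lt_iff₀ hS]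
    linarith [(key x hx).1]
  · intro h s hs
    obtain ⟨ε, hε, hball⟩ := Metric.mem_nhds_iff.1 hs
    have hδ : 0 < min (ε / 2) (1 / 2) := by positivity
    refine ((h _ hδ).and_eventually (eventually_gt_atTop 0)).mono ?_
    rintro x ⟨hlt, hx⟩
    have hS := Sfun_pos hpos hanti hx
    have hS₂ := Sfun_pos hpos hanti (by linarith : 0 < 2 * x)
    have h₁ := (div_lt_iff₀ hS).1 (hlt.trans_le (min_le_left _ _))
    have h₂ := (div_lt_iff₀ hS).1 (hlt.trans_le (min_le_right _ _))
    have hk := (key x hx).2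
    have hle := le_abs_self (Sfun μ x - Sfun μ (2 * x))
    refine hball ?_
    rw [Metric.mem_ball, Real.dist_eq, div_sub_one hS₂.ne', abs_div, abs_of_pos hS₂,
      div_lt_iff₀ hS₂]
    nlinarith
end

section
/- Let μ ∈ M be strictly positive and suppose inf_{t>0} (t·μ(t))/(∫_0^t μ(s) ds) = k > 0. Then δ̲(μ) > 1 (indeed δ̲(μ) ≥ 1/(1−k)). -/
open Filter MeasureTheory

/-- If `k * ∫₀ᵗ μ ≤ t * μ t` for all `t > 0`, then `t ↦ t⁻ᵏ * ∫₀ᵗ μ` is nondecreasing. -/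
lemma integral_mul_rpow_neg_le {μ : ℝ → ℝ} (hanti : AntitoneOn μ (Set.Ici 0))
    (hrc : ∀ x : ℝ, 0 ≤ x → ContinuousWithinAt μ (Set.Ici x) x) {k : ℝ}
    (hk : ∀ t : ℝ, 0 < t → k * (∫ s in (0:ℝ)..t, μ s) ≤ t * μ t)
    {x y : ℝ} (hx : 0 < x) (hxy : x ≤ y) :
    (∫ s in (0:ℝ)..x, μ s) * x ^ (-k) ≤ (∫ s in (0:ℝ)..y, μ s) * y ^ (-k) := by
  have hint : ∀ b : ℝ, 0 ≤ b → IntervalIntegrable μ volume 0 b := fun b hb =>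
    (hanti.mono (by rw [Set.uIcc_of_le hb]; exact Set.Icc_subset_Ici_self)).intervalIntegrable
  have hF : ∀ t : ℝ, 0 < t →
      HasDerivWithinAt (fun u => ∫ s in (0:ℝ)..u, μ s) (μ t) (Set.Ici t) t := by
    intro t ht
    refine intervalIntegral.integral_hasDerivWithinAt_right (hint t ht.le) (t := Set.Ioi t) ?_
      ((hrc t ht.le).mono Set.Ioi_subset_Ici_self)
    refine ⟨Set.Ioc 0 (t + 1), ?_, ((hint (t + 1) (by linarith)).1).aestronglyMeasurable⟩
    exact mem_nhdsWithin_of_mem_nhds (Ioc_mem_nhds ht (by linarith))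
  have hG : ∀ t : ℝ, 0 < t → HasDerivWithinAt (fun u => (∫ s in (0:ℝ)..u, μ s) * u ^ (-k))
      (μ t * t ^ (-k) + (∫ s in (0:ℝ)..t, μ s) * (-k * t ^ (-k - 1))) (Set.Ici t) t :=
    fun t ht => (hF t ht).mul (Real.hasDerivAt_rpow_const (Or.inl ht.ne')).hasDerivWithinAt
  have hcont : ContinuousOn (fun u => (∫ s in (0:ℝ)..u, μ s) * u ^ (-k)) (Set.Icc x y) := by
    refine ContinuousOn.mul ?_ (continuousOn_id.rpow_const fun t ht =>
      Or.inl (hx.trans_le ht.1).ne')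
    refine (intervalIntegral.continuousOn_primitive_interval (a := 0) (b := y) ?_).mono ?_
    · rw [Set.uIcc_of_le (hx.le.trans hxy), integrableOn_Icc_iff_integrableOn_Ioc]
      exact (hint y (hx.le.trans hxy)).1
    · rw [Set.uIcc_of_le (hx.le.trans hxy)]
      exact Set.Icc_subset_Icc_left hx.le
  refine image_le_of_deriv_right_le_deriv_boundary
    (f := fun _ => (∫ s in (0:ℝ)..x, μ s) * x ^ (-k)) (f' := fun _ => 0)
    (B := fun u => (∫ s in (0:ℝ)..u, μ s) * u ^ (-k)) (a := x) (b := y)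
    continuousOn_const (fun t _ => hasDerivWithinAt_const _ _ _) le_rfl hcont
    (fun t ht => hG t (hx.trans_le ht.1)) ?_ (Set.right_mem_Icc.2 hxy)
  intro t ht
  have ht0 : 0 < t := hx.trans_le ht.1
  have hpow : t ^ (-k) = t ^ (-k - 1) * t := by
    rw [Real.rpow_sub_one ht0.ne', div_mul_cancel₀ _ ht0.ne']
  have := mul_nonneg (Real.rpow_pos_of_pos ht0 (-k - 1)).le (sub_nonneg.2 (hk t ht0))
  rw [hpow]
  linarith

/-- If `k * ∫₀ᵗ μ ≤ t * μ t` for all `t > 0`, then `μ` decays at most like `t ^ (k - 1)`: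
`k * l ^ (k - 1) * μ x ≤ μ (l * x)`. -/
lemma mul_rpow_mul_le {μ : ℝ → ℝ} (hanti : AntitoneOn μ (Set.Ici 0))
    (hrc : ∀ x : ℝ, 0 ≤ x → ContinuousWithinAt μ (Set.Ici x) x) {k : ℝ} (hk0 : 0 ≤ k)
    (hk : ∀ t : ℝ, 0 < t → k * (∫ s in (0:ℝ)..t, μ s) ≤ t * μ t)
    (hle : ∀ t : ℝ, 0 < t → t * μ t ≤ ∫ s in (0:ℝ)..t, μ s)
    {x l : ℝ} (hx : 0 < x) (hl : 1 ≤ l) :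
    k * l ^ (k - 1) * μ x ≤ μ (l * x) := by
  have hl0 : 0 < l := one_pos.trans_le hl
  have hmono := integral_mul_rpow_neg_le hanti hrc hk hx (le_mul_of_one_le_left hx.le hl)
  rw [Real.mul_rpow hl0.le hx.le, ← mul_assoc, Real.rpow_neg hl0.le] at hmono
  have hgrow := le_of_mul_le_mul_right hmono (Real.rpow_pos_of_pos hx (-k))
  rw [← div_eq_mul_inv, le_div_iff₀ (Real.rpow_pos_of_pos hl0 k)] at hgrow
  have h : k * ((x * μ x) * l ^ k) ≤ l * x * μ (l * x) :=
    (mul_le_mul_of_nonneg_left ((mul_le_mul_of_nonneg_right (hle x hx)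
      (Real.rpow_pos_of_pos hl0 k).le).trans hgrow) hk0).trans (hk _ (mul_pos hl0 hx))
  have hpow : l ^ k = l ^ (k - 1) * l := by
    rw [Real.rpow_sub_one hl0.ne', div_mul_cancel₀ _ hl0.ne']
  rw [hpow] at h
  refine le_of_mul_le_mul_left ?_ (mul_pos hl0 hx)
  linarith

/-- Proposition 1.7 (`Prop:lessthansubc`): if `μ ∈ M` is strictly positive and
`inf_{t>0} t·μ(t)/∫₀ᵗ μ = k > 0`, then `δ̲(μ) > 1`; indeed `δ̲(μ)⁻¹ ≤ 1 - k`,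
i.e. `δ̲(μ) ≥ 1/(1-k)`. -/
theorem stmt5 (μ : ℝ → ℝ)
    (hpos : ∀ x : ℝ, 0 ≤ x → 0 < μ x)
    (hanti : AntitoneOn μ (Set.Ici 0))
    (hrc : ∀ x : ℝ, 0 ≤ x → ContinuousWithinAt μ (Set.Ici x) x)
    (hlim : Tendsto μ atTop (nhds 0))
    (k : ℝ) (hk : 0 < k)
    (hinf : IsGLB ((fun t : ℝ => t * μ t / (∫ s in Set.Ioc (0:ℝ) t, μ s)) '' Set.Ioi 0) k)
    (d : ENNReal) (hd : IsDeltaLow μ d) :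
    1 < d ∧ d⁻¹ ≤ ENNReal.ofReal (1 - k) := by
  have hle : ∀ t : ℝ, 0 < t → t * μ t ≤ ∫ s in (0:ℝ)..t, μ s := by
    intro t ht
    have h := intervalIntegral.integral_mono_on (μ := volume) ht.le (intervalIntegrable_const (c := μ t))
      (hanti.mono (by rw [Set.uIcc_of_le ht.le]; exact Set.Icc_subset_Ici_self)).intervalIntegrable
      fun s hs => hanti hs.1 ht.le hs.2
    simpa using h
  have hkF : ∀ t : ℝ, 0 < t → k * (∫ s in (0:ℝ)..t, μ s) ≤ t * μ t := by
    intro t ht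
    have h := hinf.1 (Set.mem_image_of_mem _ ht)
    rw [← intervalIntegral.integral_of_le ht.le] at h
    exact (le_div_iff₀ ((mul_pos ht (hpos t ht.le)).trans_le (hle t ht))).1 h
  have hratio : ∀ l : ℝ, 1 < l →
      ratioSup μ l ≤ ENNReal.ofReal (1 - k - Real.log k / Real.log l) := by
    intro l hl
    have hl0 : 0 < l := one_pos.trans hl
    have hlog : 0 < Real.log l := Real.log_pos hl
    refine limsup_le_of_le (h := ?_)
    filter_upwards [eventually_gt_atTop 0] with x hx
    refine ENNReal.ofReal_le_ofReal ((div_le_iff₀ hlog).2 ?_)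
    have hμx := hpos x hx.le
    have h := Real.log_le_log (by positivity)
      (mul_rpow_mul_le hanti hrc hk.le hkF hle hx hl.le)
    rw [Real.log_mul (by positivity) hμx.ne', Real.log_mul hk.ne' (by positivity),
      Real.log_rpow hl0] at h
    rw [Real.log_div hμx.ne' (hpos _ (mul_pos hl0 hx).le).ne', sub_mul, div_mul_cancel₀ _ hlog.ne']
    linarith
  obtain ⟨D, rfl, hD⟩ := hd
  have hbound : Tendsto (fun l : ℝ => ENNReal.ofReal (1 - k - Real.log k / Real.log l)) atTop
      (nhds (ENNReal.ofReal (1 - k))) := by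
    refine ENNReal.tendsto_ofReal ?_
    simpa using (Real.tendsto_log_atTop.const_div_atTop (Real.log k)).const_sub (1 - k)
  have hDk : D ≤ ENNReal.ofReal (1 - k) :=
    le_of_tendsto_of_tendsto hD hbound ((eventually_gt_atTop 1).mono hratio)
  refine ⟨ENNReal.one_lt_inv.2 (hDk.trans_lt ?_), by rwa [inv_inv]⟩
  exact ENNReal.ofReal_lt_one.2 (by linarith)
end

section
/- Let α, β ∈ M be strictly positive. Then δ̲(α⊕β) = δ̲(α∨β), δ̄(α⊕β) = δ̄(α∨β), d̲(α⊕β) = d̲(α∨β) and d̄(α⊕β) = d̄(α∨β). -/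
open Filter MeasureTheory

/-- `d̲(μ) = (limsup_{x→∞} log(1/μ(x))/log x)⁻¹` in `[0,∞]`. -/
noncomputable def dLowF (μ : ℝ → ℝ) : ENNReal :=
  (Filter.limsup (fun x : ℝ => ENNReal.ofReal (Real.log (1 / μ x) / Real.log x))
    Filter.atTop)⁻¹

/-- The distribution function `λ_μ(t)` = Lebesgue measure of `{x ≥ 0 : μ(x) > t}`. -/
noncomputable def distr (μ : ℝ → ℝ) (t : ℝ) : ENNReal :=
  volume {x : ℝ | 0 ≤ x ∧ t < μ x}

/-- The direct sum `α⊕β`, i.e. the non-increasing rearrangement with distribution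
function `λ_α + λ_β`: `(α⊕β)(x) = inf{t ≥ 0 : λ_α(t) + λ_β(t) ≤ x}`. -/
noncomputable def dsum (α β : ℝ → ℝ) (x : ℝ) : ℝ :=
  sInf {t : ℝ | 0 ≤ t ∧ distr α t + distr β t ≤ ENNReal.ofReal x}

theorem ENNReal.limsup_add_le_add {ι : Type*} {f : Filter ι} (u v : ι → ENNReal) :
    limsup (fun x => u x + v x) f ≤ limsup u f + limsup v f := by
  rw [limsup_eq_iInf_iSup (u := u), limsup_eq_iInf_iSup (u := v)]
  refine ENNReal.le_iInf₂_add_iInf₂ fun s hs t ht => limsup_le_of_le (by isBoundedDefault) ?_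
  filter_upwards [hs, ht] with x hxs hxt
  exact add_le_add (le_iSup₂ (f := fun a (_ : a ∈ s) => u a) x hxs)
    (le_iSup₂ (f := fun a (_ : a ∈ t) => v a) x hxt)

theorem ENNReal.add_le_liminf_add {ι : Type*} {f : Filter ι} (u v : ι → ENNReal) :
    liminf u f + liminf v f ≤ liminf (fun x => u x + v x) f := by
  rw [liminf_eq_iSup_iInf (u := u), liminf_eq_iSup_iInf (u := v)]
  refine ENNReal.biSup_add_biSup_le' ⟨_, univ_mem⟩ ⟨_, univ_mem⟩ fun s hs t ht =>
    le_liminf_of_le (by isBoundedDefault) ?_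
  filter_upwards [hs, ht] with x hxs hxt
  exact add_le_add (iInf₂_le (f := fun a (_ : a ∈ s) => u a) x hxs)
    (iInf₂_le (f := fun a (_ : a ∈ t) => v a) x hxt)

theorem limsup_mul_left_atTop {β : Type*} [CompleteLattice β] (u : ℝ → β) {c : ℝ} (hc : 0 < c) :
    limsup (fun x => u (c * x)) atTop = limsup u atTop := by
  have h := limsup_comp u (fun x => c * x) atTop
  have hm : map (fun x => c * x) atTop = atTop := (OrderIso.mulLeft₀ c hc).map_atTop
  rwa [hm] at h

theorem liminf_mul_left_atTop {β : Type*} [CompleteLattice β] (u : ℝ → β) {c : ℝ} (hc : 0 < c) :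
    liminf (fun x => u (c * x)) atTop = liminf u atTop :=
  limsup_mul_left_atTop (β := βᵒᵈ) u hc

/-- Fekete's lemma for monotone subadditive functions on `(0, ∞)` with values in `[0, ∞]`. -/
theorem exists_tendsto_mul_inv_of_subadditive {f : ℝ → ENNReal}
    (hmono : ∀ s t, 0 < s → s ≤ t → f s ≤ f t)
    (hadd : ∀ s t, 0 < s → 0 < t → f (s + t) ≤ f s + f t) :
    ∃ D, Tendsto (fun s => f s * ENNReal.ofReal s⁻¹) atTop (nhds D) := by
  have hmul : ∀ (n : ℕ) (s : ℝ), 0 < s → f ((n + 1) * s) ≤ (n + 1) * f s := by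
    intro n s hs
    induction n with
    | zero => simp
    | succ k ih =>
      have h := hadd ((k + 1) * s) s (by positivity) hs
      push_cast
      calc f ((k + 1 + 1) * s) = f ((k + 1) * s + s) := by ring_nf
        _ ≤ f ((k + 1) * s) + f s := h
        _ ≤ (k + 1) * f s + f s := by gcongr
        _ = (k + 1 + 1) * f s := by ring
  have key : ∀ s₀, 0 < s₀ → limsup (fun s => f s * ENNReal.ofReal s⁻¹) atTop ≤
      f s₀ * ENNReal.ofReal s₀⁻¹ := by
    intro s₀ hs₀
    have hlim : Tendsto (fun s : ℝ => f s₀ * ENNReal.ofReal (s₀⁻¹ + s⁻¹)) atTop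
        (nhds (f s₀ * ENNReal.ofReal s₀⁻¹)) := by
      refine ENNReal.Tendsto.const_mul ?_ (Or.inl (by simpa using hs₀))
      refine ENNReal.tendsto_ofReal ?_
      simpa using tendsto_inv_atTop_zero.const_add s₀⁻¹
    rw [← hlim.limsup_eq]
    refine limsup_le_limsup ?_
    filter_upwards [eventually_gt_atTop 0] with s hs
    have hn := Nat.floor_le (div_nonneg hs.le hs₀.le)
    have hn' := Nat.lt_floor_add_one (s / s₀)
    set n := ⌊s / s₀⌋₊
    have h1 : f s ≤ (n + 1) * f s₀ :=
      (hmono s _ hs ((div_lt_iff₀ hs₀).1 hn').le).trans (hmul n s₀ hs₀)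
    calc f s * ENNReal.ofReal s⁻¹ ≤ ((n + 1) * f s₀) * ENNReal.ofReal s⁻¹ := by gcongr
      _ = f s₀ * (ENNReal.ofReal (n + 1) * ENNReal.ofReal s⁻¹) := by
        rw [ENNReal.ofReal_add (by positivity) zero_le_one]
        simp
        ring
      _ = f s₀ * ENNReal.ofReal ((n + 1) * s⁻¹) := by
        rw [ENNReal.ofReal_mul (by positivity)]
      _ ≤ f s₀ * ENNReal.ofReal (s₀⁻¹ + s⁻¹) := by
        gcongr
        rw [add_mul, one_mul]
        gcongr
        calc n * s⁻¹ ≤ s / s₀ * s⁻¹ := by gcongr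
          _ = s₀⁻¹ := by field_simp
  refine ⟨_, tendsto_of_le_liminf_of_limsup_le (a := limsup (fun s => f s * ENNReal.ofReal s⁻¹) atTop)
    (le_liminf_of_le (by isBoundedDefault) ?_) le_rfl⟩
  filter_upwards [eventually_gt_atTop 0] with s hs using key s hs

/-- Fekete's lemma for monotone superadditive functions on `(0, ∞)` with values in `[0, ∞]`. -/
theorem exists_tendsto_mul_inv_of_superadditive {f : ℝ → ENNReal}
    (hmono : ∀ s t, 0 < s → s ≤ t → f s ≤ f t)
    (hadd : ∀ s t, 0 < s → 0 < t → f s + f t ≤ f (s + t)) :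
    ∃ D, Tendsto (fun s => f s * ENNReal.ofReal s⁻¹) atTop (nhds D) := by
  have hmul : ∀ (n : ℕ) (s : ℝ), 0 < s → (n + 1) * f s ≤ f ((n + 1) * s) := by
    intro n s hs
    induction n with
    | zero => simp
    | succ k ih =>
      have h := hadd ((k + 1) * s) s (by positivity) hs
      push_cast
      calc ((k : ENNReal) + 1 + 1) * f s = (k + 1) * f s + f s := by ring
        _ ≤ f ((k + 1) * s) + f s := by gcongr
        _ ≤ f ((k + 1) * s + s) := h
        _ = f ((k + 1 + 1) * s) := by ring_nf
  have key : ∀ s₀, 0 < s₀ → f s₀ * ENNReal.ofReal s₀⁻¹ ≤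
      liminf (fun s => f s * ENNReal.ofReal s⁻¹) atTop := by
    intro s₀ hs₀
    have hlim : Tendsto (fun s : ℝ => f s₀ * ENNReal.ofReal (s₀⁻¹ - s⁻¹)) atTop
        (nhds (f s₀ * ENNReal.ofReal s₀⁻¹)) := by
      refine ENNReal.Tendsto.const_mul ?_ (Or.inl (by simpa using hs₀))
      refine ENNReal.tendsto_ofReal ?_
      simpa using tendsto_inv_atTop_zero.const_sub s₀⁻¹
    rw [← hlim.liminf_eq]
    refine liminf_le_liminf ?_
    filter_upwards [eventually_ge_atTop s₀] with s hs₁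
    have hs : 0 < s := hs₀.trans_le hs₁
    have hn := Nat.floor_le (div_nonneg hs.le hs₀.le)
    have hn' := Nat.lt_floor_add_one (s / s₀)
    have hpos : 1 ≤ ⌊s / s₀⌋₊ := Nat.le_floor (by simpa using (one_le_div hs₀).2 hs₁)
    obtain ⟨n, hn_eq⟩ := Nat.exists_eq_add_of_le' hpos
    rw [hn_eq] at hn hn'
    push_cast at hn hn'
    have h1 : (n + 1) * f s₀ ≤ f s :=
      (hmul n s₀ hs₀).trans (hmono _ s (by positivity) ((le_div_iff₀ hs₀).1 hn))
    calc f s₀ * ENNReal.ofReal (s₀⁻¹ - s⁻¹) ≤ f s₀ * ENNReal.ofReal ((n + 1) * s⁻¹) := by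
          gcongr
          calc s₀⁻¹ - s⁻¹ = (s / s₀ - 1) * s⁻¹ := by field_simp
            _ ≤ (n + 1) * s⁻¹ := by
              gcongr
              linarith
      _ = f s₀ * (ENNReal.ofReal (n + 1) * ENNReal.ofReal s⁻¹) := by
        rw [ENNReal.ofReal_mul (by positivity)]
      _ = ((n + 1) * f s₀) * ENNReal.ofReal s⁻¹ := by
        rw [ENNReal.ofReal_add (by positivity) zero_le_one]
        simp
        ring
      _ ≤ f s * ENNReal.ofReal s⁻¹ := by gcongr
  refine ⟨_, tendsto_of_le_liminf_of_limsup_le (a := liminf (fun s => f s * ENNReal.ofReal s⁻¹) atTop)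
    le_rfl (limsup_le_of_le (by isBoundedDefault) ?_)⟩
  filter_upwards [eventually_gt_atTop 0] with s hs using key s hs

theorem tendsto_shift_mul_inv {f : ℝ → ENNReal} {D : ENNReal}
    (hf : Tendsto (fun s => f s * ENNReal.ofReal s⁻¹) atTop (nhds D)) (c : ℝ) :
    Tendsto (fun s => f (s + c) * ENNReal.ofReal s⁻¹) atTop (nhds D) := by
  have h1 : Tendsto (fun s : ℝ => s + c) atTop atTop := tendsto_atTop_add_const_right _ c tendsto_id
  have h2 : Tendsto (fun s : ℝ => ENNReal.ofReal (1 + c * s⁻¹)) atTop (nhds 1) := by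
    rw [← ENNReal.ofReal_one]
    refine ENNReal.tendsto_ofReal ?_
    simpa using (tendsto_inv_atTop_zero.const_mul c).const_add (1 : ℝ)
  have h3 := ENNReal.Tendsto.mul (hf.comp h1) (Or.inr ENNReal.one_ne_top) h2 (Or.inl one_ne_zero)
  rw [mul_one] at h3
  refine h3.congr' ?_
  filter_upwards [eventually_gt_atTop 0, eventually_gt_atTop (-c)] with s hs hsc
  have hsc' : 0 < s + c := by linarith
  simp only [Function.comp]
  rw [mul_assoc, ← ENNReal.ofReal_mul (by positivity)]
  congr 2
  field_simp

theorem tendsto_mul_inv_of_shift_le {f g : ℝ → ENNReal} {D : ENNReal} {c : ℝ}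
    (hf : Tendsto (fun s => f s * ENNReal.ofReal s⁻¹) atTop (nhds D))
    (hlow : ∀ᶠ s in atTop, f (s - c) ≤ g s) (hup : ∀ᶠ s in atTop, g s ≤ f (s + c)) :
    Tendsto (fun s => g s * ENNReal.ofReal s⁻¹) atTop (nhds D) := by
  refine tendsto_of_tendsto_of_tendsto_of_le_of_le' (tendsto_shift_mul_inv hf (-c))
    (tendsto_shift_mul_inv hf c) ?_ ?_
  · filter_upwards [hlow] with s hs
    rw [← sub_eq_add_neg]
    gcongr
  · filter_upwards [hup] with s hs
    gcongr

/-- The logarithmic decrease of `μ` between `x` and `exp s * x`. -/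
noncomputable def logDrop (μ : ℝ → ℝ) (s x : ℝ) : ENNReal :=
  ENNReal.ofReal (Real.log (μ x / μ (Real.exp s * x)))

theorem logDrop_le_logDrop {μ ν : ℝ → ℝ} {s t x y : ℝ} (hμ : 0 < μ x)
    (hν : 0 < ν (Real.exp t * y)) (h1 : μ x ≤ ν y)
    (h2 : ν (Real.exp t * y) ≤ μ (Real.exp s * x)) : logDrop μ s x ≤ logDrop ν t y := by
  refine ENNReal.ofReal_le_ofReal (Real.log_le_log (div_pos hμ (hν.trans_le h2)) ?_)
  exact div_le_div₀ (hμ.le.trans h1) h1 hν h2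

theorem logDrop_add {μ : ℝ → ℝ} (hpos : ∀ x, 0 ≤ x → 0 < μ x) (hanti : AntitoneOn μ (Set.Ici 0))
    {s t x : ℝ} (hs : 0 ≤ s) (ht : 0 ≤ t) (hx : 0 ≤ x) :
    logDrop μ (s + t) x = logDrop μ s x + logDrop μ t (Real.exp s * x) := by
  have hsx : 0 ≤ Real.exp s * x := by positivity
  have htx : 0 ≤ Real.exp t * (Real.exp s * x) := by positivity
  have hle : ∀ {r y : ℝ}, 0 ≤ r → 0 ≤ y → 0 ≤ Real.log (μ y / μ (Real.exp r * y)) := by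
    intro r y hr hy
    have hry : 0 ≤ Real.exp r * y := by positivity
    refine Real.log_nonneg ((one_le_div (hpos _ hry)).2 (hanti hy hry ?_))
    exact le_mul_of_one_le_left hy (Real.one_le_exp hr)
  unfold logDrop
  rw [← ENNReal.ofReal_add (hle hs hx) (hle ht hsx),
    ← Real.log_mul (div_pos (hpos _ hx) (hpos _ hsx)).ne' (div_pos (hpos _ hsx) (hpos _ htx)).ne',
    div_mul_div_cancel₀ (hpos _ hsx).ne', ← mul_assoc, ← Real.exp_add, add_comm t s]

theorem logDrop_mono {μ : ℝ → ℝ} (hpos : ∀ x, 0 ≤ x → 0 < μ x) (hanti : AntitoneOn μ (Set.Ici 0))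
    {s t x : ℝ} (hst : s ≤ t) (hx : 0 ≤ x) : logDrop μ s x ≤ logDrop μ t x := by
  refine logDrop_le_logDrop (hpos x hx) (hpos _ (by positivity)) le_rfl (hanti ?_ ?_ (by gcongr))
  all_goals exact Set.mem_Ici.2 (by positivity)

theorem ofReal_log_div_eq_logDrop {μ : ℝ → ℝ} {l : ℝ} (hl : 1 < l) (x : ℝ) :
    ENNReal.ofReal (Real.log (μ x / μ (l * x)) / Real.log l) =
      ENNReal.ofReal (Real.log l)⁻¹ * logDrop μ (Real.log l) x := by
  have hlog := Real.log_pos hl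
  rw [logDrop, Real.exp_log (by linarith), div_eq_inv_mul, ENNReal.ofReal_mul (by positivity)]

theorem tendsto_ratioSup {μ : ℝ → ℝ} {D : ENNReal}
    (h : Tendsto (fun s => limsup (logDrop μ s) atTop * ENNReal.ofReal s⁻¹) atTop (nhds D)) :
    Tendsto (ratioSup μ) atTop (nhds D) := by
  refine (h.comp Real.tendsto_log_atTop).congr' ?_
  filter_upwards [eventually_gt_atTop 1] with l hl
  simp only [ratioSup, ofReal_log_div_eq_logDrop hl, Function.comp]
  rw [ENNReal.limsup_const_mul_of_ne_top ENNReal.ofReal_ne_top, mul_comm]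

theorem tendsto_ratioInf {μ : ℝ → ℝ} {D : ENNReal}
    (h : Tendsto (fun s => liminf (logDrop μ s) atTop * ENNReal.ofReal s⁻¹) atTop (nhds D)) :
    Tendsto (ratioInf μ) atTop (nhds D) := by
  refine (h.comp Real.tendsto_log_atTop).congr' ?_
  filter_upwards [eventually_gt_atTop 1] with l hl
  simp only [ratioInf, ofReal_log_div_eq_logDrop hl, Function.comp]
  rw [ENNReal.liminf_const_mul_of_ne_top ENNReal.ofReal_ne_top, mul_comm]

theorem exists_tendsto_limsup_logDrop {μ : ℝ → ℝ} (hpos : ∀ x, 0 ≤ x → 0 < μ x)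
    (hanti : AntitoneOn μ (Set.Ici 0)) :
    ∃ D, Tendsto (fun s => limsup (logDrop μ s) atTop * ENNReal.ofReal s⁻¹) atTop (nhds D) := by
  refine exists_tendsto_mul_inv_of_subadditive (fun s t _ hst => limsup_le_limsup ?_)
    fun s t hs ht => ?_
  · filter_upwards [eventually_ge_atTop 0] with x hx using logDrop_mono hpos hanti hst hx
  · have h : logDrop μ (s + t) =ᶠ[atTop] fun x => logDrop μ s x + logDrop μ t (Real.exp s * x) := by
      filter_upwards [eventually_ge_atTop 0] with x hx using logDrop_add hpos hanti hs.le ht.le hx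
    rw [limsup_congr h, ← limsup_mul_left_atTop (logDrop μ t) (Real.exp_pos s)]
    exact ENNReal.limsup_add_le_add _ _

theorem exists_tendsto_liminf_logDrop {μ : ℝ → ℝ} (hpos : ∀ x, 0 ≤ x → 0 < μ x)
    (hanti : AntitoneOn μ (Set.Ici 0)) :
    ∃ D, Tendsto (fun s => liminf (logDrop μ s) atTop * ENNReal.ofReal s⁻¹) atTop (nhds D) := by
  refine exists_tendsto_mul_inv_of_superadditive (fun s t _ hst => liminf_le_liminf ?_)
    fun s t hs ht => ?_
  · filter_upwards [eventually_ge_atTop 0] with x hx using logDrop_mono hpos hanti hst hx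
  · have h : logDrop μ (s + t) =ᶠ[atTop] fun x => logDrop μ s x + logDrop μ t (Real.exp s * x) := by
      filter_upwards [eventually_ge_atTop 0] with x hx using logDrop_add hpos hanti hs.le ht.le hx
    rw [liminf_congr h, ← liminf_mul_left_atTop (logDrop μ t) (Real.exp_pos s)]
    exact ENNReal.add_le_liminf_add _ _

section Comparison

variable {μ ν : ℝ → ℝ}

theorem logDrop_le_of_le_half (hpos : ∀ x, 0 ≤ x → 0 < μ x) (hle : ∀ x, 0 ≤ x → μ x ≤ ν x)
    (hhalf : ∀ x, 0 ≤ x → ν x ≤ μ (2⁻¹ * x)) (s : ℝ) :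
    ∀ᶠ x in atTop, logDrop ν s x ≤ logDrop μ (s + Real.log 2) (2⁻¹ * x) := by
  filter_upwards [eventually_ge_atTop 0] with x hx
  have hsx : 0 ≤ Real.exp s * x := by positivity
  have h : Real.exp (s + Real.log 2) * (2⁻¹ * x) = Real.exp s * x := by
    rw [Real.exp_add, Real.exp_log two_pos]
    ring
  refine logDrop_le_logDrop ((hpos x hx).trans_le (hle x hx)) ?_ (hhalf x hx) ?_ <;> rw [h]
  exacts [hpos _ hsx, hle _ hsx]

theorem le_logDrop_of_le_half (hpos : ∀ x, 0 ≤ x → 0 < μ x) (hle : ∀ x, 0 ≤ x → μ x ≤ ν x)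
    (hhalf : ∀ x, 0 ≤ x → ν x ≤ μ (2⁻¹ * x)) (s : ℝ) :
    ∀ᶠ x in atTop, logDrop μ (s - Real.log 2) x ≤ logDrop ν s x := by
  filter_upwards [eventually_ge_atTop 0] with x hx
  have hsx : 0 ≤ Real.exp s * x := by positivity
  refine logDrop_le_logDrop (hpos x hx) ((hpos _ hsx).trans_le (hle _ hsx)) (hle x hx) ?_
  rw [Real.exp_sub, Real.exp_log two_pos, div_mul_eq_mul_div, div_eq_inv_mul]
  exact hhalf _ hsx

theorem exists_isDeltaLow_of_le_half (hpos : ∀ x, 0 ≤ x → 0 < μ x)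
    (hanti : AntitoneOn μ (Set.Ici 0)) (hle : ∀ x, 0 ≤ x → μ x ≤ ν x)
    (hhalf : ∀ x, 0 ≤ x → ν x ≤ μ (2⁻¹ * x)) : ∃ d, IsDeltaLow ν d ∧ IsDeltaLow μ d := by
  obtain ⟨D, hD⟩ := exists_tendsto_limsup_logDrop hpos hanti
  refine ⟨D⁻¹, ⟨D, rfl, tendsto_ratioSup (tendsto_mul_inv_of_shift_le (c := Real.log 2) hD ?_ ?_)⟩,
    D, rfl, tendsto_ratioSup hD⟩
  · exact .of_forall fun s => limsup_le_limsup (le_logDrop_of_le_half hpos hle hhalf s)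
  · refine .of_forall fun s => ?_
    rw [← limsup_mul_left_atTop (logDrop μ (s + Real.log 2)) (inv_pos.2 two_pos)]
    exact limsup_le_limsup (logDrop_le_of_le_half hpos hle hhalf s)

theorem exists_isDeltaUp_of_le_half (hpos : ∀ x, 0 ≤ x → 0 < μ x)
    (hanti : AntitoneOn μ (Set.Ici 0)) (hle : ∀ x, 0 ≤ x → μ x ≤ ν x)
    (hhalf : ∀ x, 0 ≤ x → ν x ≤ μ (2⁻¹ * x)) : ∃ d, IsDeltaUp ν d ∧ IsDeltaUp μ d := by
  obtain ⟨D, hD⟩ := exists_tendsto_liminf_logDrop hpos hanti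
  refine ⟨D⁻¹, ⟨D, rfl, tendsto_ratioInf (tendsto_mul_inv_of_shift_le (c := Real.log 2) hD ?_ ?_)⟩,
    D, rfl, tendsto_ratioInf hD⟩
  · exact .of_forall fun s => liminf_le_liminf (le_logDrop_of_le_half hpos hle hhalf s)
  · refine .of_forall fun s => ?_
    rw [← liminf_mul_left_atTop (logDrop μ (s + Real.log 2)) (inv_pos.2 two_pos)]
    exact liminf_le_liminf (logDrop_le_of_le_half hpos hle hhalf s)

/-- The exponent of polynomial decay of `μ` at scale `x`. -/
noncomputable def decayExp (μ : ℝ → ℝ) (x : ℝ) : ENNReal :=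
  ENNReal.ofReal (Real.log (1 / μ x) / Real.log x)

theorem decayExp_le_of_le (hpos : ∀ x, 0 ≤ x → 0 < μ x) (hle : ∀ x, 0 ≤ x → μ x ≤ ν x) :
    ∀ᶠ x in atTop, decayExp ν x ≤ decayExp μ x := by
  filter_upwards [eventually_gt_atTop 1] with x hx
  have hx0 : 0 ≤ x := by linarith
  have hμ := hpos x hx0
  have hlog := Real.log_pos hx
  have hν := hμ.trans_le (hle x hx0)
  refine ENNReal.ofReal_le_ofReal (div_le_div_of_nonneg_right (Real.log_le_log ?_ ?_) hlog.le)
  · positivity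
  · exact one_div_le_one_div_of_le hμ (hle x hx0)

theorem decayExp_mul_le_of_le_half (hpos : ∀ x, 0 ≤ x → 0 < μ x) (hle : ∀ x, 0 ≤ x → μ x ≤ ν x)
    (hhalf : ∀ x, 0 ≤ x → ν x ≤ μ (2⁻¹ * x)) :
    ∀ᶠ x in atTop, decayExp μ (2⁻¹ * x) *
      ENNReal.ofReal (Real.log (2⁻¹ * x) / Real.log x) ≤ decayExp ν x := by
  filter_upwards [eventually_gt_atTop 2] with x hx
  have hx0 : 0 ≤ x := by linarith
  have hν := (hpos x hx0).trans_le (hle x hx0)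
  have hlog := Real.log_pos (show 1 < x by linarith)
  have hlog' := Real.log_pos (show 1 < 2⁻¹ * x by linarith)
  have hμ := hν.trans_le (hhalf x hx0)
  rw [decayExp, decayExp, ← ENNReal.ofReal_mul' (by positivity), div_mul_div_cancel₀ hlog'.ne']
  refine ENNReal.ofReal_le_ofReal (div_le_div_of_nonneg_right (Real.log_le_log ?_ ?_) hlog.le)
  · positivity
  · exact one_div_le_one_div_of_le hν (hhalf x hx0)

theorem tendsto_ofReal_log_half_div_log :
    Tendsto (fun x => ENNReal.ofReal (Real.log (2⁻¹ * x) / Real.log x)) atTop (nhds 1) := by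
  rw [← ENNReal.ofReal_one]
  refine ENNReal.tendsto_ofReal ?_
  have h := ((tendsto_inv_atTop_zero.comp Real.tendsto_log_atTop).const_mul
    (Real.log 2⁻¹)).add_const 1
  rw [mul_zero, zero_add] at h
  refine h.congr' ?_
  filter_upwards [eventually_gt_atTop 1] with x hx
  have hlog := Real.log_pos hx
  rw [Real.log_mul (by norm_num) (by linarith), add_div, div_self hlog.ne', div_eq_mul_inv]
  rfl

theorem dLowF_eq_of_le_half (hpos : ∀ x, 0 ≤ x → 0 < μ x) (hle : ∀ x, 0 ≤ x → μ x ≤ ν x)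
    (hhalf : ∀ x, 0 ≤ x → ν x ≤ μ (2⁻¹ * x)) : dLowF ν = dLowF μ := by
  refine congrArg (·⁻¹) (le_antisymm (a := limsup (decayExp ν) atTop) (b := limsup (decayExp μ) atTop)
    (limsup_le_limsup (decayExp_le_of_le hpos hle)) ?_)
  rw [← limsup_mul_left_atTop (decayExp μ) (inv_pos.2 two_pos), ← mul_one (limsup _ _),
    ← tendsto_ofReal_log_half_div_log.liminf_eq]
  exact ENNReal.le_limsup_mul.trans
    (limsup_le_limsup (decayExp_mul_le_of_le_half hpos hle hhalf))

theorem dUpF_eq_of_le_half (hpos : ∀ x, 0 ≤ x → 0 < μ x) (hle : ∀ x, 0 ≤ x → μ x ≤ ν x)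
    (hhalf : ∀ x, 0 ≤ x → ν x ≤ μ (2⁻¹ * x)) : dUpF ν = dUpF μ := by
  refine congrArg (·⁻¹) (le_antisymm (a := liminf (decayExp ν) atTop) (b := liminf (decayExp μ) atTop)
    (liminf_le_liminf (decayExp_le_of_le hpos hle)) ?_)
  rw [← liminf_mul_left_atTop (decayExp μ) (inv_pos.2 two_pos), ← mul_one (liminf _ _),
    ← tendsto_ofReal_log_half_div_log.liminf_eq]
  exact ENNReal.le_liminf_mul.trans
    (liminf_le_liminf (decayExp_mul_le_of_le_half hpos hle hhalf))

end Comparison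

theorem distr_le_of_le {μ : ℝ → ℝ} (hanti : AntitoneOn μ (Set.Ici 0)) {x t : ℝ} (hx : 0 ≤ x)
    (h : μ x ≤ t) : distr μ t ≤ ENNReal.ofReal x := by
  have hsub : {y : ℝ | 0 ≤ y ∧ t < μ y} ⊆ Set.Ico 0 x := fun y hy =>
    ⟨hy.1, lt_of_not_ge fun hxy => (hy.2.trans_le (hanti hx hy.1 hxy)).not_ge h⟩
  simpa [distr] using measure_mono (μ := volume) hsub

theorem le_of_distr_le {μ : ℝ → ℝ} (hanti : AntitoneOn μ (Set.Ici 0)) {x t : ℝ} (hx : 0 ≤ x)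
    (hrc : ContinuousWithinAt μ (Set.Ici x) x) (h : distr μ t ≤ ENNReal.ofReal x) : μ x ≤ t := by
  by_contra! hlt
  have hev : ∀ᶠ y in nhdsWithin x (Set.Ici x), t < μ y := hrc.eventually (lt_mem_nhds hlt)
  obtain ⟨y, hxy, hy⟩ := (mem_nhdsGE_iff_exists_Icc_subset).1 hev
  have hxy : x < y := hxy
  have hsub : Set.Ico 0 y ⊆ {z : ℝ | 0 ≤ z ∧ t < μ z} := fun z hz =>
    ⟨hz.1, (hy ⟨hxy.le, le_rfl⟩ : t < μ y).trans_le (hanti hz.1 (hx.trans hxy.le) hz.2.le)⟩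
  have hmeas : ENNReal.ofReal y ≤ distr μ t := by
    simpa [distr] using measure_mono (μ := volume) hsub
  exact hxy.not_ge ((ENNReal.ofReal_le_ofReal_iff hx).1 (hmeas.trans h))

theorem max_half_mem_dsum_set {α β : ℝ → ℝ} (hposα : ∀ x, 0 ≤ x → 0 < α x)
    (hantiα : AntitoneOn α (Set.Ici 0)) (hantiβ : AntitoneOn β (Set.Ici 0)) {x : ℝ} (hx : 0 ≤ x) :
    max (α (2⁻¹ * x)) (β (2⁻¹ * x)) ∈
      {t : ℝ | 0 ≤ t ∧ distr α t + distr β t ≤ ENNReal.ofReal x} := by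
  have hx2 : 0 ≤ 2⁻¹ * x := by positivity
  refine ⟨(hposα _ hx2).le.trans (le_max_left _ _), ?_⟩
  refine (add_le_add (distr_le_of_le hantiα hx2 (le_max_left _ _))
    (distr_le_of_le hantiβ hx2 (le_max_right _ _))).trans ?_
  rw [← ENNReal.ofReal_add hx2 hx2]
  exact ENNReal.ofReal_le_ofReal (by linarith)

theorem dsum_le_max_half {α β : ℝ → ℝ} (hposα : ∀ x, 0 ≤ x → 0 < α x)
    (hantiα : AntitoneOn α (Set.Ici 0)) (hantiβ : AntitoneOn β (Set.Ici 0)) {x : ℝ} (hx : 0 ≤ x) :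
    dsum α β x ≤ max (α (2⁻¹ * x)) (β (2⁻¹ * x)) :=
  csInf_le ⟨0, fun _ ht => ht.1⟩ (max_half_mem_dsum_set hposα hantiα hantiβ hx)

theorem max_le_dsum {α β : ℝ → ℝ} (hposα : ∀ x, 0 ≤ x → 0 < α x)
    (hantiα : AntitoneOn α (Set.Ici 0)) (hantiβ : AntitoneOn β (Set.Ici 0)) {x : ℝ} (hx : 0 ≤ x)
    (hrcα : ContinuousWithinAt α (Set.Ici x) x) (hrcβ : ContinuousWithinAt β (Set.Ici x) x) :
    max (α x) (β x) ≤ dsum α β x :=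
  le_csInf ⟨_, max_half_mem_dsum_set hposα hantiα hantiβ hx⟩ fun _ ht =>
    max_le (le_of_distr_le hantiα hx hrcα (le_self_add.trans ht.2))
      (le_of_distr_le hantiβ hx hrcβ (le_add_self.trans ht.2))

/-- Proposition 1.10 (`sumeqsup`): for strictly positive `α, β ∈ M`,
`δ̲(α⊕β) = δ̲(α∨β)`, `δ̄(α⊕β) = δ̄(α∨β)`, `d̲(α⊕β) = d̲(α∨β)` and `d̄(α⊕β) = d̄(α∨β)`. -/
theorem stmt8 (α β : ℝ → ℝ)
    (hposα : ∀ x : ℝ, 0 ≤ x → 0 < α x) (hposβ : ∀ x : ℝ, 0 ≤ x → 0 < β x)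
    (hantiα : AntitoneOn α (Set.Ici 0)) (hantiβ : AntitoneOn β (Set.Ici 0))
    (hrcα : ∀ x : ℝ, 0 ≤ x → ContinuousWithinAt α (Set.Ici x) x)
    (hrcβ : ∀ x : ℝ, 0 ≤ x → ContinuousWithinAt β (Set.Ici x) x)
    (hlimα : Tendsto α atTop (nhds 0)) (hlimβ : Tendsto β atTop (nhds 0)) :
    (∃ d : ENNReal, IsDeltaLow (dsum α β) d ∧ IsDeltaLow (fun x => max (α x) (β x)) d) ∧
    (∃ d : ENNReal, IsDeltaUp (dsum α β) d ∧ IsDeltaUp (fun x => max (α x) (β x)) d) ∧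
    dLowF (dsum α β) = dLowF (fun x => max (α x) (β x)) ∧
    dUpF (dsum α β) = dUpF (fun x => max (α x) (β x)) := by
  have hpos : ∀ x, 0 ≤ x → 0 < max (α x) (β x) := fun x hx => lt_max_of_lt_left (hposα x hx)
  have hanti : AntitoneOn (fun x => max (α x) (β x)) (Set.Ici 0) := fun x hx y hy hxy =>
    max_le_max (hantiα hx hy hxy) (hantiβ hx hy hxy)
  have hle : ∀ x, 0 ≤ x → max (α x) (β x) ≤ dsum α β x := fun x hx =>
    max_le_dsum hposα hantiα hantiβ hx (hrcα x hx) (hrcβ x hx)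
  have hhalf : ∀ x, 0 ≤ x → dsum α β x ≤ max (α (2⁻¹ * x)) (β (2⁻¹ * x)) := fun x hx =>
    dsum_le_max_half hposα hantiα hantiβ hx
  exact ⟨exists_isDeltaLow_of_le_half hpos hanti hle hhalf,
    exists_isDeltaUp_of_le_half hpos hanti hle hhalf,
    dLowF_eq_of_le_half hpos hle hhalf, dUpF_eq_of_le_half hpos hle hhalf⟩
end

section
/- Let α, β ∈ M be strictly positive. Then δ̲(α⊕β) ≥ min(δ̲(α), δ̲(β)), δ̄(α⊕β) ≤ max(δ̄(α), δ̄(β)), d̲(α⊕β) ≥ max(d̲(α), d̲(β)), and d̄(α⊕β) = max(d̄(α), d̄(β)). -/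
open Filter MeasureTheory

/-- The functions in `M` that are strictly positive. -/
structure IsPosDecay (μ : ℝ → ℝ) : Prop where
  pos : ∀ x : ℝ, 0 ≤ x → 0 < μ x
  anti : AntitoneOn μ (Set.Ici 0)
  rightCont : ∀ x : ℝ, 0 ≤ x → ContinuousWithinAt μ (Set.Ici x) x
  lim : Tendsto μ atTop (nhds 0)

theorem le_of_forall_pos_lt_imp_le {a b : ℝ} (hb : 0 ≤ b)
    (h : ∀ t, 0 < t → t < a → t ≤ b) : a ≤ b := by
  by_contra! hab
  obtain ⟨t, hbt, hta⟩ := exists_between hab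
  exact absurd (h t (hb.trans_lt hbt) hta) (not_le.mpr hbt)

theorem distr_antitone (μ : ℝ → ℝ) : Antitone (distr μ) := fun _ _ hst =>
  measure_mono fun _ hx => ⟨hx.1, hst.trans_lt hx.2⟩

/-- The superlevel set of a function in `M` at a positive height is `[0, s)`. -/
theorem IsPosDecay.exists_distr_eq {μ : ℝ → ℝ} (h : IsPosDecay μ) {t : ℝ} (ht : 0 < t) :
    ∃ s : ℝ, 0 ≤ s ∧ distr μ t = ENNReal.ofReal s ∧ ∀ x, 0 ≤ x → (t < μ x ↔ x < s) := by
  set S : Set ℝ := {x : ℝ | 0 ≤ x ∧ t < μ x}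
  obtain ⟨b, hb⟩ := eventually_atTop.mp (h.lim.eventually (gt_mem_nhds ht))
  have hbdd : BddAbove S :=
    ⟨b, fun x hx => le_of_not_ge fun hbx => lt_asymm hx.2 (hb x hbx)⟩
  have hs0 : 0 ≤ sSup S := Real.sSup_nonneg fun x hx => hx.1
  have key : ∀ x, 0 ≤ x → (t < μ x ↔ x < sSup S) := by
    intro x hx
    constructor
    · intro htx
      have hev : ∀ᶠ y in nhdsWithin x (Set.Ioi x), t < μ y :=
        ((h.rightCont x hx).mono Set.Ioi_subset_Ici_self).eventually (lt_mem_nhds htx)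
      obtain ⟨y, hy, hxy⟩ := (hev.and self_mem_nhdsWithin).exists
      exact lt_of_lt_of_le hxy (le_csSup hbdd ⟨hx.trans (le_of_lt hxy), hy⟩)
    · intro hxs
      have hne : S.Nonempty := by
        by_contra hne
        rw [Set.not_nonempty_iff_eq_empty.mp hne, Real.sSup_empty] at hxs
        linarith
      obtain ⟨y, hy, hxy⟩ := exists_lt_of_lt_csSup hne hxs
      exact hy.2.trans_le (h.anti hx hy.1 hxy.le)
  refine ⟨sSup S, hs0, ?_, key⟩
  have hIco : S = Set.Ico 0 (sSup S) := by
    ext x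
    exact and_congr_right fun hx => key x hx
  calc volume S = volume (Set.Ico 0 (sSup S)) := congrArg _ hIco
    _ = _ := by rw [Real.volume_Ico, sub_zero]

theorem IsPosDecay.mul_distr_le {μ : ℝ → ℝ} (h : IsPosDecay μ) {A l X t : ℝ} (hA : 0 < A)
    (hl : 0 < l) (hX : 0 ≤ X) (hμ : ∀ x, X ≤ x → μ x ≤ A * μ (l * x)) (ht : 0 < t)
    (htX : A * t < μ X) : ENNReal.ofReal l * distr μ (A * t) ≤ distr μ t := by
  obtain ⟨s, hs, hds, hms⟩ := h.exists_distr_eq (mul_pos hA ht)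
  obtain ⟨r, hr, hdr, hmr⟩ := h.exists_distr_eq ht
  rw [hds, hdr, ← ENNReal.ofReal_mul hl.le]
  refine ENNReal.ofReal_le_ofReal ?_
  by_contra! hlt
  set y := max X (r / l)
  have hXy : X ≤ y := le_max_left _ _
  have hys : y < s := max_lt ((hms X hX).mp htX) ((div_lt_iff₀' hl).mpr hlt)
  have h1 : A * t < A * μ (l * y) := ((hms y (hX.trans hXy)).mpr hys).trans_le (hμ y hXy)
  have h2 := (hmr (l * y) (mul_nonneg hl.le (hX.trans hXy))).mp (lt_of_mul_lt_mul_left h1 hA.le)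
  exact absurd h2 (not_lt.mpr ((div_le_iff₀' hl).mp (le_max_right _ _)))

theorem IsPosDecay.distr_le_mul {μ : ℝ → ℝ} (h : IsPosDecay μ) {A l X t : ℝ} (hA : 0 < A)
    (hl : 0 < l) (hX : 0 ≤ X) (hμ : ∀ x, X ≤ x → A * μ (l * x) ≤ μ x) (ht : 0 < t)
    (htX : t < μ (l * X)) : distr μ t ≤ ENNReal.ofReal l * distr μ (A * t) := by
  obtain ⟨s, hs, hds, hms⟩ := h.exists_distr_eq (mul_pos hA ht)
  obtain ⟨r, hr, hdr, hmr⟩ := h.exists_distr_eq ht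
  rw [hds, hdr, ← ENNReal.ofReal_mul hl.le]
  refine ENNReal.ofReal_le_ofReal ?_
  by_contra! hlt
  set y := max X s
  have hXy : X ≤ y := le_max_left _ _
  have hy0 : 0 ≤ y := hX.trans hXy
  have hlX := (hmr (l * X) (mul_nonneg hl.le hX)).mp htX
  have hyr : l * y < r := by
    rw [← lt_div_iff₀' hl] at hlt hlX ⊢
    exact max_lt hlX hlt
  have h1 : A * t < μ y :=
    (mul_lt_mul_of_pos_left ((hmr (l * y) (mul_nonneg hl.le hy0)).mpr hyr) hA).trans_le (hμ y hXy)
  exact absurd ((hms y hy0).mp h1) (not_lt.mpr (le_max_right _ _))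

section DirectSum

variable {α β : ℝ → ℝ}

theorem dsum_nonneg (α β : ℝ → ℝ) (x : ℝ) : 0 ≤ dsum α β x :=
  Real.sInf_nonneg fun _ ht => ht.1

theorem lt_distr_of_lt_dsum {t x : ℝ} (ht : 0 ≤ t) (h : t < dsum α β x) :
    ENNReal.ofReal x < distr α t + distr β t := by
  by_contra! hle
  exact absurd (show dsum α β x ≤ t from csInf_le ⟨0, fun _ hs => hs.1⟩ ⟨ht, hle⟩) (not_le.mpr h)

theorem IsPosDecay.le_dsum_of_lt_distr (hα : IsPosDecay α) (hβ : IsPosDecay β) {t x : ℝ}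
    (h : ENNReal.ofReal x < distr α t + distr β t) : t ≤ dsum α β x := by
  have hzero : ∀ {μ : ℝ → ℝ}, IsPosDecay μ → ∀ {u}, μ 0 ≤ u → distr μ u = 0 := by
    intro μ hμ u hu
    have : {x : ℝ | 0 ≤ x ∧ u < μ x} = ∅ := by
      ext y
      simp only [Set.mem_ofPred_eq, Set.mem_empty_iff_false, iff_false, not_and, not_lt]
      exact fun hy => (hμ.anti Set.self_mem_Ici hy hy).trans hu
    rw [distr, this, measure_empty]
  refine le_csInf ⟨max (α 0) (β 0), (hα.pos 0 le_rfl).le.trans (le_max_left _ _), ?_⟩ ?_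
  · rw [hzero hα (le_max_left _ _), hzero hβ (le_max_right _ _), add_zero]
    exact zero_le
  · intro b hb
    by_contra! hbt
    exact absurd (h.trans_le ((add_le_add (distr_antitone α hbt.le)
      (distr_antitone β hbt.le)).trans hb.2)) (lt_irrefl _)

theorem dsum_comm (α β : ℝ → ℝ) : dsum α β = dsum β α := by
  funext x
  simp only [dsum, add_comm]

theorem IsPosDecay.le_dsum_left (hα : IsPosDecay α) (hβ : IsPosDecay β) {x : ℝ} (hx : 0 ≤ x) :
    α x ≤ dsum α β x := by
  refine le_of_forall_pos_lt_imp_le (dsum_nonneg α β x) fun t ht htx => ?_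
  obtain ⟨s, hs, hds, hms⟩ := hα.exists_distr_eq ht
  have hxs := (hms x hx).mp htx
  refine hα.le_dsum_of_lt_distr hβ (lt_of_lt_of_le ?_ le_self_add)
  rw [hds]
  exact (ENNReal.ofReal_lt_ofReal_iff (hx.trans_lt hxs)).mpr hxs

theorem IsPosDecay.le_dsum_right (hα : IsPosDecay α) (hβ : IsPosDecay β) {x : ℝ} (hx : 0 ≤ x) :
    β x ≤ dsum α β x :=
  dsum_comm β α ▸ hβ.le_dsum_left hα hx

theorem IsPosDecay.dsum_pos (hα : IsPosDecay α) (hβ : IsPosDecay β) {x : ℝ} (hx : 0 ≤ x) :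
    0 < dsum α β x :=
  (hα.pos x hx).trans_le (hα.le_dsum_left hβ hx)

theorem IsPosDecay.dsum_antitone (hα : IsPosDecay α) (hβ : IsPosDecay β) :
    Antitone (dsum α β) := by
  intro x y hxy
  refine le_of_forall_pos_lt_imp_le (dsum_nonneg α β x) fun t ht hty => ?_
  exact hα.le_dsum_of_lt_distr hβ
    ((ENNReal.ofReal_le_ofReal hxy).trans_lt (lt_distr_of_lt_dsum ht.le hty))

theorem IsPosDecay.dsum_le_max (hα : IsPosDecay α) (hβ : IsPosDecay β) {x : ℝ} (hx : 0 ≤ x) :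
    dsum α β x ≤ max (α (x / 2)) (β (x / 2)) := by
  by_contra! hlt
  set t := max (α (x / 2)) (β (x / 2))
  have hx2 : 0 ≤ x / 2 := by positivity
  have ht0 : 0 < t := (hα.pos _ hx2).trans_le (le_max_left _ _)
  obtain ⟨s, hs, hds, hms⟩ := hα.exists_distr_eq ht0
  obtain ⟨r, hr, hdr, hmr⟩ := hβ.exists_distr_eq ht0
  have h := lt_distr_of_lt_dsum ht0.le hlt
  rw [hds, hdr, ← ENNReal.ofReal_add hs hr] at h
  have hxsr := (ENNReal.ofReal_lt_ofReal_iff'.mp h).1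
  have h1 : s ≤ x / 2 := not_lt.mp ((hms _ hx2).not.mp (not_lt.mpr (le_max_left _ _)))
  have h2 : r ≤ x / 2 := not_lt.mp ((hmr _ hx2).not.mp (not_lt.mpr (le_max_right _ _)))
  linarith

theorem IsPosDecay.tendsto_dsum (hα : IsPosDecay α) (hβ : IsPosDecay β) :
    Tendsto (dsum α β) atTop (nhds 0) := by
  have hhalf : Tendsto (fun x : ℝ => x / 2) atTop atTop := tendsto_id.atTop_div_const two_pos
  have hmax : Tendsto (fun x : ℝ => max (α (x / 2)) (β (x / 2))) atTop (nhds 0) := by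
    simpa using (hα.lim.comp hhalf).max (hβ.lim.comp hhalf)
  refine tendsto_of_tendsto_of_tendsto_of_le_of_le' tendsto_const_nhds hmax
    (Eventually.of_forall (dsum_nonneg α β)) ?_
  filter_upwards [eventually_ge_atTop 0] with x hx using hα.dsum_le_max hβ hx

theorem IsPosDecay.eventually_dsum_le (hα : IsPosDecay α) (hβ : IsPosDecay β) {A l : ℝ}
    (hA : 0 < A) (hl : 0 < l) (h1 : ∀ᶠ x in atTop, α x ≤ A * α (l * x))
    (h2 : ∀ᶠ x in atTop, β x ≤ A * β (l * x)) :
    ∀ᶠ x in atTop, dsum α β x ≤ A * dsum α β (l * x) := by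
  obtain ⟨X, hX⟩ := eventually_atTop.mp ((h1.and h2).and (eventually_ge_atTop 0))
  have hX0 : 0 ≤ X := (hX X le_rfl).2
  have hsmall := (hα.tendsto_dsum hβ).eventually
    (gt_mem_nhds (lt_min (hα.pos X hX0) (hβ.pos X hX0)))
  filter_upwards [hsmall] with x hx
  rw [← div_le_iff₀' hA]
  refine le_of_forall_pos_lt_imp_le (dsum_nonneg α β _) fun t ht htx => ?_
  rw [lt_div_iff₀' hA] at htx
  refine hα.le_dsum_of_lt_distr hβ ?_
  have h3 := hα.mul_distr_le hA hl hX0 (fun y hy => (hX y hy).1.1) ht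
    (htx.trans (hx.trans_le (min_le_left _ _)))
  have h4 := hβ.mul_distr_le hA hl hX0 (fun y hy => (hX y hy).1.2) ht
    (htx.trans (hx.trans_le (min_le_right _ _)))
  refine lt_of_lt_of_le ?_ (add_le_add h3 h4)
  rw [← mul_add, ENNReal.ofReal_mul hl.le]
  exact ENNReal.mul_lt_mul_right (ENNReal.ofReal_pos.mpr hl).ne' ENNReal.ofReal_ne_top
    (lt_distr_of_lt_dsum (mul_pos hA ht).le htx)

theorem IsPosDecay.eventually_le_dsum (hα : IsPosDecay α) (hβ : IsPosDecay β) {A l : ℝ}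
    (hA : 0 < A) (hl : 0 < l) (h1 : ∀ᶠ x in atTop, A * α (l * x) ≤ α x)
    (h2 : ∀ᶠ x in atTop, A * β (l * x) ≤ β x) :
    ∀ᶠ x in atTop, A * dsum α β (l * x) ≤ dsum α β x := by
  obtain ⟨X, hX⟩ := eventually_atTop.mp ((h1.and h2).and (eventually_ge_atTop 0))
  have hX0 : 0 ≤ X := (hX X le_rfl).2
  have hlX : 0 ≤ l * X := mul_nonneg hl.le hX0
  have hsmall := ((hα.tendsto_dsum hβ).comp (tendsto_id.const_mul_atTop hl)).eventually
    (gt_mem_nhds (lt_min (hα.pos _ hlX) (hβ.pos _ hlX)))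
  filter_upwards [hsmall] with x hx
  simp only [Function.comp_apply, id_eq] at hx
  rw [← le_div_iff₀' hA]
  refine le_of_forall_pos_lt_imp_le (div_nonneg (dsum_nonneg α β _) hA.le) fun t ht htx => ?_
  rw [le_div_iff₀' hA]
  refine hα.le_dsum_of_lt_distr hβ ?_
  have h3 := hα.distr_le_mul hA hl hX0 (fun y hy => (hX y hy).1.1) ht
    (htx.trans (hx.trans_le (min_le_left _ _)))
  have h4 := hβ.distr_le_mul hA hl hX0 (fun y hy => (hX y hy).1.2) ht
    (htx.trans (hx.trans_le (min_le_right _ _)))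
  have h5 := (lt_distr_of_lt_dsum ht.le htx).trans_le (add_le_add h3 h4)
  rw [← mul_add, ENNReal.ofReal_mul hl.le] at h5
  exact lt_of_mul_lt_mul_left h5 zero_le

end DirectSum

section Ratio

variable {μ : ℝ → ℝ}

theorem log_ratio_div_le_iff (hpos : ∀ x, 0 ≤ x → 0 < μ x) {l c x : ℝ} (hl : 1 < l)
    (hx : 0 ≤ x) :
    Real.log (μ x / μ (l * x)) / Real.log l ≤ c ↔ μ x ≤ l ^ c * μ (l * x) := by
  have h1 := hpos x hx
  have h2 := hpos (l * x) (by positivity)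
  rw [div_le_iff₀ (Real.log_pos hl), ← Real.log_rpow (by positivity),
    Real.log_le_log_iff (by positivity) (by positivity), div_le_iff₀ h2]

theorem le_log_ratio_div_iff (hpos : ∀ x, 0 ≤ x → 0 < μ x) {l c x : ℝ} (hl : 1 < l)
    (hx : 0 ≤ x) :
    c ≤ Real.log (μ x / μ (l * x)) / Real.log l ↔ l ^ c * μ (l * x) ≤ μ x := by
  have h1 := hpos x hx
  have h2 := hpos (l * x) (by positivity)
  rw [le_div_iff₀ (Real.log_pos hl), ← Real.log_rpow (by positivity),
    Real.log_le_log_iff (by positivity) (by positivity), le_div_iff₀ h2]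

theorem eventually_le_of_ratioSup_lt (hpos : ∀ x, 0 ≤ x → 0 < μ x) {l : ℝ} (hl : 1 < l)
    {c : NNReal} (h : ratioSup μ l < c) :
    ∀ᶠ x in atTop, μ x ≤ l ^ (c : ℝ) * μ (l * x) := by
  filter_upwards [eventually_lt_of_limsup_lt h, eventually_ge_atTop 0] with x hx hx0
  rw [← log_ratio_div_le_iff hpos hl hx0]
  rw [← ENNReal.ofReal_coe_nnreal] at hx
  exact (ENNReal.ofReal_le_ofReal_iff c.2).mp hx.le

theorem ratioSup_le_of_eventually_le (hpos : ∀ x, 0 ≤ x → 0 < μ x) {l : ℝ} (hl : 1 < l)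
    {c : NNReal} (h : ∀ᶠ x in atTop, μ x ≤ l ^ (c : ℝ) * μ (l * x)) : ratioSup μ l ≤ c := by
  refine limsup_le_of_le (h := ?_)
  filter_upwards [h, eventually_ge_atTop 0] with x hx hx0
  rw [← log_ratio_div_le_iff hpos hl hx0] at hx
  rw [← ENNReal.ofReal_coe_nnreal]
  exact ENNReal.ofReal_le_ofReal hx

theorem eventually_le_of_lt_ratioInf (hpos : ∀ x, 0 ≤ x → 0 < μ x) {l : ℝ} (hl : 1 < l)
    {c : NNReal} (h : c < ratioInf μ l) :
    ∀ᶠ x in atTop, l ^ (c : ℝ) * μ (l * x) ≤ μ x := by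
  filter_upwards [eventually_lt_of_lt_liminf h, eventually_ge_atTop 0] with x hx hx0
  rw [← le_log_ratio_div_iff hpos hl hx0]
  rw [← ENNReal.ofReal_coe_nnreal] at hx
  exact (ENNReal.ofReal_lt_ofReal_iff'.mp hx).1.le

theorem le_ratioInf_of_eventually_le (hpos : ∀ x, 0 ≤ x → 0 < μ x) {l : ℝ} (hl : 1 < l)
    {c : NNReal} (h : ∀ᶠ x in atTop, l ^ (c : ℝ) * μ (l * x) ≤ μ x) : c ≤ ratioInf μ l := by
  refine le_liminf_of_le (h := ?_)
  filter_upwards [h, eventually_ge_atTop 0] with x hx hx0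
  rw [← le_log_ratio_div_iff hpos hl hx0] at hx
  rw [← ENNReal.ofReal_coe_nnreal]
  exact ENNReal.ofReal_le_ofReal hx

theorem le_pow_mul_of_le_mul {A m X : ℝ} (hA : 0 < A) (hm : 1 < m) (hX : 0 ≤ X)
    (h : ∀ x, X ≤ x → μ x ≤ A * μ (m * x)) (n : ℕ) {x : ℝ} (hx : X ≤ x) :
    μ x ≤ A ^ n * μ (m ^ n * x) := by
  induction n with
  | zero => simp
  | succ n ih =>
    have hXn : X ≤ m ^ n * x :=
      hx.trans (le_mul_of_one_le_left (hX.trans hx) (one_le_pow₀ hm.le))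
    calc μ x ≤ A ^ n * μ (m ^ n * x) := ih
      _ ≤ A ^ n * (A * μ (m * (m ^ n * x))) := by gcongr; exact h _ hXn
      _ = A ^ (n + 1) * μ (m ^ (n + 1) * x) := by ring_nf

theorem pow_mul_le_of_mul_le {A m X : ℝ} (hA : 0 < A) (hm : 1 < m) (hX : 0 ≤ X)
    (h : ∀ x, X ≤ x → A * μ (m * x) ≤ μ x) (n : ℕ) {x : ℝ} (hx : X ≤ x) :
    A ^ n * μ (m ^ n * x) ≤ μ x := by
  induction n with
  | zero => simp
  | succ n ih =>
    have hXn : X ≤ m ^ n * x :=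
      hx.trans (le_mul_of_one_le_left (hX.trans hx) (one_le_pow₀ hm.le))
    calc A ^ (n + 1) * μ (m ^ (n + 1) * x) = A ^ n * (A * μ (m * (m ^ n * x))) := by ring_nf
      _ ≤ A ^ n * μ (m ^ n * x) := by gcongr; exact h _ hXn
      _ ≤ μ x := ih

theorem eventually_mul_log_add_le (a : ℝ) {c d : ℝ} (hcd : c < d) :
    ∀ᶠ l : ℝ in atTop, c * Real.log l + a ≤ d * Real.log l := by
  filter_upwards [Real.tendsto_log_atTop.eventually_ge_atTop (a / (d - c))] with l hl
  rw [div_le_iff₀ (sub_pos.mpr hcd)] at hl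
  linarith

theorem limsup_ratioSup_le (hpos : ∀ x, 0 ≤ x → 0 < μ x) (hanti : AntitoneOn μ (Set.Ici 0))
    {m : ℝ} (hm : 1 < m) : limsup (ratioSup μ) atTop ≤ ratioSup μ m := by
  refine le_of_forall_gt_imp_ge_of_dense fun e he => ?_
  obtain ⟨c, hmc, hce⟩ := ENNReal.lt_iff_exists_nnreal_btwn.mp he
  obtain ⟨d, hcd, hde⟩ := ENNReal.lt_iff_exists_nnreal_btwn.mp hce
  have hcd' : (c : ℝ) < d := by exact_mod_cast hcd
  obtain ⟨X, hX⟩ := eventually_atTop.mp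
    ((eventually_le_of_ratioSup_lt hpos hm hmc).and (eventually_ge_atTop 0))
  have hX0 : 0 ≤ X := (hX X le_rfl).2
  have hm0 : 0 < m := one_pos.trans hm
  have hlm := Real.log_pos hm
  refine le_trans (limsup_le_of_le (h := ?_)) hde.le
  filter_upwards [eventually_mul_log_add_le (c * Real.log m) hcd', eventually_gt_atTop 1]
    with l hl hl1
  have hl0 : 0 < l := one_pos.trans hl1
  refine ratioSup_le_of_eventually_le hpos hl1 ?_
  filter_upwards [eventually_ge_atTop X] with x hx
  have hx0 := hX0.trans hx
  set n := ⌈Real.log l / Real.log m⌉₊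
  have hn1 : Real.log l ≤ n * Real.log m := (div_le_iff₀ hlm).mp (Nat.le_ceil _)
  have hn2 : n * Real.log m ≤ Real.log l + Real.log m := by
    have := (Nat.ceil_lt_add_one (div_nonneg (Real.log_pos hl1).le hlm.le)).le
    calc n * Real.log m ≤ (Real.log l / Real.log m + 1) * Real.log m := by gcongr
      _ = Real.log l + Real.log m := by field_simp
  have hlmn : l ≤ m ^ n := by
    rwa [← Real.log_le_log_iff hl0 (by positivity), Real.log_pow]
  have hA : (m ^ (c : ℝ)) ^ n ≤ l ^ (d : ℝ) := by
    rw [← Real.log_le_log_iff (by positivity) (by positivity), Real.log_pow,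
      Real.log_rpow hm0, Real.log_rpow hl0]
    nlinarith [c.2]
  have hpl := (hpos (l * x) (by positivity)).le
  calc μ x ≤ (m ^ (c : ℝ)) ^ n * μ (m ^ n * x) :=
        le_pow_mul_of_le_mul (by positivity) hm hX0 (fun y hy => (hX y hy).1) n hx
    _ ≤ (m ^ (c : ℝ)) ^ n * μ (l * x) := by
        gcongr
        exact hanti (Set.mem_Ici.mpr (by positivity)) (Set.mem_Ici.mpr (by positivity))
          (by gcongr)
    _ ≤ l ^ (d : ℝ) * μ (l * x) := by gcongr

theorem ratioInf_le_liminf (hpos : ∀ x, 0 ≤ x → 0 < μ x) (hanti : AntitoneOn μ (Set.Ici 0))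
    {m : ℝ} (hm : 1 < m) : ratioInf μ m ≤ liminf (ratioInf μ) atTop := by
  refine le_of_forall_lt_imp_le_of_dense fun e he => ?_
  obtain ⟨d, hed, hdm⟩ := ENNReal.lt_iff_exists_nnreal_btwn.mp he
  obtain ⟨c, hdc, hcm⟩ := ENNReal.lt_iff_exists_nnreal_btwn.mp hdm
  have hdc' : (d : ℝ) < c := by exact_mod_cast hdc
  obtain ⟨X, hX⟩ := eventually_atTop.mp
    ((eventually_le_of_lt_ratioInf hpos hm hcm).and (eventually_ge_atTop 0))
  have hX0 : 0 ≤ X := (hX X le_rfl).2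
  have hm0 : 0 < m := one_pos.trans hm
  have hlm := Real.log_pos hm
  refine le_trans hed.le (le_liminf_of_le (h := ?_))
  filter_upwards [eventually_mul_log_add_le (c * Real.log m) hdc', eventually_gt_atTop 1]
    with l hl hl1
  have hl0 : 0 < l := one_pos.trans hl1
  refine le_ratioInf_of_eventually_le hpos hl1 ?_
  filter_upwards [eventually_ge_atTop X] with x hx
  have hx0 := hX0.trans hx
  set n := ⌊Real.log l / Real.log m⌋₊
  have hn1 : n * Real.log m ≤ Real.log l :=
    (le_div_iff₀ hlm).mp (Nat.floor_le (div_nonneg (Real.log_pos hl1).le hlm.le))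
  have hn2 : Real.log l ≤ n * Real.log m + Real.log m := by
    have := (div_le_iff₀ hlm).mp (Nat.lt_floor_add_one (Real.log l / Real.log m)).le
    linarith
  have hlmn : m ^ n ≤ l := by
    rwa [← Real.log_le_log_iff (by positivity) hl0, Real.log_pow]
  have hA : l ^ (d : ℝ) ≤ (m ^ (c : ℝ)) ^ n := by
    rw [← Real.log_le_log_iff (by positivity) (by positivity), Real.log_pow,
      Real.log_rpow hm0, Real.log_rpow hl0]
    nlinarith [c.2]
  have hpl := (hpos (l * x) (by positivity)).le
  calc l ^ (d : ℝ) * μ (l * x) ≤ (m ^ (c : ℝ)) ^ n * μ (l * x) := by gcongr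
    _ ≤ (m ^ (c : ℝ)) ^ n * μ (m ^ n * x) := by
        gcongr
        exact hanti (Set.mem_Ici.mpr (by positivity)) (Set.mem_Ici.mpr (by positivity))
          (by gcongr)
    _ ≤ μ x := pow_mul_le_of_mul_le (by positivity) hm hX0 (fun y hy => (hX y hy).1) n hx

theorem exists_tendsto_ratioSup (hpos : ∀ x, 0 ≤ x → 0 < μ x)
    (hanti : AntitoneOn μ (Set.Ici 0)) : ∃ D, Tendsto (ratioSup μ) atTop (nhds D) := by
  refine ⟨limsup (ratioSup μ) atTop, tendsto_of_le_liminf_of_limsup_le ?_ le_rfl⟩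
  refine le_liminf_of_le (h := ?_)
  filter_upwards [eventually_gt_atTop 1] with m hm using limsup_ratioSup_le hpos hanti hm

theorem exists_tendsto_ratioInf (hpos : ∀ x, 0 ≤ x → 0 < μ x)
    (hanti : AntitoneOn μ (Set.Ici 0)) : ∃ D, Tendsto (ratioInf μ) atTop (nhds D) := by
  refine ⟨liminf (ratioInf μ) atTop, tendsto_of_le_liminf_of_limsup_le le_rfl ?_⟩
  refine limsup_le_of_le (h := ?_)
  filter_upwards [eventually_gt_atTop 1] with m hm using ratioInf_le_liminf hpos hanti hm

end Ratio

section Estimates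

variable {α β : ℝ → ℝ}

theorem IsPosDecay.ratioSup_dsum_le (hα : IsPosDecay α) (hβ : IsPosDecay β) {l : ℝ}
    (hl : 1 < l) : ratioSup (dsum α β) l ≤ max (ratioSup α l) (ratioSup β l) := by
  refine le_of_forall_gt_imp_ge_of_dense fun e he => ?_
  obtain ⟨c, hc, hce⟩ := ENNReal.lt_iff_exists_nnreal_btwn.mp he
  refine le_trans (ratioSup_le_of_eventually_le (fun x hx => hα.dsum_pos hβ hx) hl ?_) hce.le
  exact hα.eventually_dsum_le hβ (by positivity) (one_pos.trans hl)
    (eventually_le_of_ratioSup_lt hα.pos hl ((le_max_left _ _).trans_lt hc))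
    (eventually_le_of_ratioSup_lt hβ.pos hl ((le_max_right _ _).trans_lt hc))

theorem IsPosDecay.le_ratioInf_dsum (hα : IsPosDecay α) (hβ : IsPosDecay β) {l : ℝ}
    (hl : 1 < l) : min (ratioInf α l) (ratioInf β l) ≤ ratioInf (dsum α β) l := by
  refine le_of_forall_lt_imp_le_of_dense fun e he => ?_
  obtain ⟨c, hec, hc⟩ := ENNReal.lt_iff_exists_nnreal_btwn.mp he
  refine le_trans hec.le (le_ratioInf_of_eventually_le (fun x hx => hα.dsum_pos hβ hx) hl ?_)
  exact hα.eventually_le_dsum hβ (by positivity) (one_pos.trans hl)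
    (eventually_le_of_lt_ratioInf hα.pos hl (hc.trans_le (min_le_left _ _)))
    (eventually_le_of_lt_ratioInf hβ.pos hl (hc.trans_le (min_le_right _ _)))

theorem ofReal_log_one_div_le {a b x : ℝ} (ha : 0 < a) (hab : a ≤ b) (hx : 1 < x) :
    ENNReal.ofReal (Real.log (1 / b) / Real.log x) ≤
      ENNReal.ofReal (Real.log (1 / a) / Real.log x) := by
  have := Real.log_pos hx
  have hb := ha.trans_le hab
  gcongr

theorem dLowF_mono {μ ν : ℝ → ℝ} (hμ : ∀ x, 0 ≤ x → 0 < μ x)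
    (h : ∀ x, 0 ≤ x → μ x ≤ ν x) : dLowF μ ≤ dLowF ν := by
  refine ENNReal.inv_le_inv.mpr (limsup_le_limsup ?_)
  filter_upwards [eventually_gt_atTop 1] with x hx
  have hx0 : 0 ≤ x := zero_le_one.trans hx.le
  exact ofReal_log_one_div_le (hμ x hx0) (h x hx0) hx

theorem dUpF_mono {μ ν : ℝ → ℝ} (hμ : ∀ x, 0 ≤ x → 0 < μ x)
    (h : ∀ x, 0 ≤ x → μ x ≤ ν x) : dUpF μ ≤ dUpF ν := by
  refine ENNReal.inv_le_inv.mpr (liminf_le_liminf ?_)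
  filter_upwards [eventually_gt_atTop 1] with x hx
  have hx0 : 0 ≤ x := zero_le_one.trans hx.le
  exact ofReal_log_one_div_le (hμ x hx0) (h x hx0) hx

theorem eventually_log_one_div_half {μ : ℝ → ℝ} {c : NNReal}
    (h : c < liminf (fun x : ℝ => ENNReal.ofReal (Real.log (1 / μ x) / Real.log x)) atTop) :
    ∀ᶠ x : ℝ in atTop, c * (Real.log x - Real.log 2) ≤ -Real.log (μ (x / 2)) := by
  have hhalf : Tendsto (fun x : ℝ => x / 2) atTop atTop := tendsto_id.atTop_div_const two_pos
  filter_upwards [hhalf.eventually (eventually_lt_of_lt_liminf h), eventually_gt_atTop 2]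
    with x hx hx2
  rw [← ENNReal.ofReal_coe_nnreal] at hx
  have h1 := (ENNReal.ofReal_lt_ofReal_iff'.mp hx).1
  have hx1 : 1 < x / 2 := by linarith
  rw [lt_div_iff₀ (Real.log_pos hx1), Real.log_div (by positivity) two_ne_zero, one_div,
    Real.log_inv] at h1
  exact h1.le

theorem IsPosDecay.dUpF_dsum_le (hα : IsPosDecay α) (hβ : IsPosDecay β) :
    dUpF (dsum α β) ≤ max (dUpF α) (dUpF β) := by
  rw [dUpF, dUpF, dUpF, ← ENNReal.inv_strictAnti.antitone.map_min, ENNReal.inv_le_inv]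
  refine le_of_forall_lt_imp_le_of_dense fun e he => ?_
  obtain ⟨d, hed, hdm⟩ := ENNReal.lt_iff_exists_nnreal_btwn.mp he
  obtain ⟨c, hdc, hcm⟩ := ENNReal.lt_iff_exists_nnreal_btwn.mp hdm
  have hdc' : (d : ℝ) < c := by exact_mod_cast hdc
  refine le_trans hed.le (le_liminf_of_le (h := ?_))
  filter_upwards [eventually_log_one_div_half (hcm.trans_le (min_le_left _ _)),
    eventually_log_one_div_half (hcm.trans_le (min_le_right _ _)),
    eventually_mul_log_add_le (c * Real.log 2) hdc', eventually_gt_atTop 1] with x h1 h2 h3 hx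
  have hx0 : 0 ≤ x := zero_le_one.trans hx.le
  rw [← ENNReal.ofReal_coe_nnreal]
  refine ENNReal.ofReal_le_ofReal ?_
  rw [le_div_iff₀ (Real.log_pos hx), one_div, Real.log_inv]
  have h4 := Real.log_le_log (hα.dsum_pos hβ hx0) (hα.dsum_le_max hβ hx0)
  rcases max_choice (α (x / 2)) (β (x / 2)) with h | h <;> rw [h] at h4 <;> linarith

end Estimates

/-- Proposition 1.11 (`estimates`): for strictly positive `α, β ∈ M`,
`δ̲(α⊕β) ≥ δ̲(α) ∧ δ̲(β)`, `δ̄(α⊕β) ≤ δ̄(α) ∨ δ̄(β)`, `d̲(α⊕β) ≥ d̲(α) ∨ d̲(β)` and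
`d̄(α⊕β) = d̄(α) ∨ d̄(β)`. -/
theorem stmt9 (α β : ℝ → ℝ)
    (hposα : ∀ x : ℝ, 0 ≤ x → 0 < α x) (hposβ : ∀ x : ℝ, 0 ≤ x → 0 < β x)
    (hantiα : AntitoneOn α (Set.Ici 0)) (hantiβ : AntitoneOn β (Set.Ici 0))
    (hrcα : ∀ x : ℝ, 0 ≤ x → ContinuousWithinAt α (Set.Ici x) x)
    (hrcβ : ∀ x : ℝ, 0 ≤ x → ContinuousWithinAt β (Set.Ici x) x)
    (hlimα : Tendsto α atTop (nhds 0)) (hlimβ : Tendsto β atTop (nhds 0)) :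
    (∃ d dα dβ : ENNReal, IsDeltaLow (dsum α β) d ∧ IsDeltaLow α dα ∧ IsDeltaLow β dβ ∧
      min dα dβ ≤ d) ∧
    (∃ d dα dβ : ENNReal, IsDeltaUp (dsum α β) d ∧ IsDeltaUp α dα ∧ IsDeltaUp β dβ ∧
      d ≤ max dα dβ) ∧
    max (dLowF α) (dLowF β) ≤ dLowF (dsum α β) ∧
    dUpF (dsum α β) = max (dUpF α) (dUpF β) := by
  have hα : IsPosDecay α := ⟨hposα, hantiα, hrcα, hlimα⟩
  have hβ : IsPosDecay β := ⟨hposβ, hantiβ, hrcβ, hlimβ⟩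
  have hpos : ∀ x, 0 ≤ x → 0 < dsum α β x := fun x hx => hα.dsum_pos hβ hx
  have hanti := (hα.dsum_antitone hβ).antitoneOn (Set.Ici 0)
  refine ⟨?_, ?_, ?_, ?_⟩
  · obtain ⟨D, hD⟩ := exists_tendsto_ratioSup hpos hanti
    obtain ⟨Dα, hDα⟩ := exists_tendsto_ratioSup hposα hantiα
    obtain ⟨Dβ, hDβ⟩ := exists_tendsto_ratioSup hposβ hantiβ
    refine ⟨D⁻¹, Dα⁻¹, Dβ⁻¹, ⟨D, rfl, hD⟩, ⟨Dα, rfl, hDα⟩, ⟨Dβ, rfl, hDβ⟩, ?_⟩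
    rw [← ENNReal.inv_strictAnti.antitone.map_max, ENNReal.inv_le_inv]
    refine le_of_tendsto_of_tendsto hD (hDα.max hDβ) ?_
    filter_upwards [eventually_gt_atTop 1] with l hl using hα.ratioSup_dsum_le hβ hl
  · obtain ⟨D, hD⟩ := exists_tendsto_ratioInf hpos hanti
    obtain ⟨Dα, hDα⟩ := exists_tendsto_ratioInf hposα hantiα
    obtain ⟨Dβ, hDβ⟩ := exists_tendsto_ratioInf hposβ hantiβ
    refine ⟨D⁻¹, Dα⁻¹, Dβ⁻¹, ⟨D, rfl, hD⟩, ⟨Dα, rfl, hDα⟩, ⟨Dβ, rfl, hDβ⟩, ?_⟩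
    rw [← ENNReal.inv_strictAnti.antitone.map_min, ENNReal.inv_le_inv]
    refine le_of_tendsto_of_tendsto (hDα.min hDβ) hD ?_
    filter_upwards [eventually_gt_atTop 1] with l hl using hα.le_ratioInf_dsum hβ hl
  · exact max_le (dLowF_mono hposα fun x hx => hα.le_dsum_left hβ hx)
      (dLowF_mono hposβ fun x hx => hα.le_dsum_right hβ hx)
  · exact le_antisymm (hα.dUpF_dsum_le hβ)
      (max_le (dUpF_mono hposα fun x hx => hα.le_dsum_left hβ hx)
        (dUpF_mono hposβ fun x hx => hα.le_dsum_right hβ hx))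
end
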